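/- Let f be a function of finite order ρ(f) in the Eremenko–Lyubich class B. Suppose that the set {z ∈ Δ : |f(z)| < exp(|z|^{ρ(f)/2+ε})} has finite logarithmic area for some ε > 0. Then logarea(Δ \ A(f)) < ∞. In particular, since A(f) ⊆ J(f) for f ∈ B, logarea(Δ \ J(f)) < ∞ and area J(f) > 0. -/

import Mathlib

open MeasureTheory Filter Metric Set Topology ENNReal

/-- Logarithmic area of a subset of the plane. -/
noncomputable def logArea (A : Set ℂ) : ℝ≥0∞ :=
  ∫⁻ z in A, ENNReal.ofReal ((‖z‖ ^ 2)⁻¹)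

/-- The set Δ = {z : |z| ≥ 1}. -/
def Delta : Set ℂ := {z : ℂ | 1 ≤ ‖z‖}

/-- Chordal (spherical) distance on the Riemann sphere ℂ ∪ {∞}, with ∞ encoded as `none`. -/
noncomputable def chordalDist : Option ℂ → Option ℂ → ℝ
  | none, none => 0
  | none, some w => 2 / Real.sqrt (1 + ‖w‖ ^ 2)
  | some z, none => 2 / Real.sqrt (1 + ‖z‖ ^ 2)
  | some z, some w =>
      2 * ‖z - w‖ / (Real.sqrt (1 + ‖z‖ ^ 2) * Real.sqrt (1 + ‖w‖ ^ 2))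

/-- Locally uniform convergence on `U` of a sequence of ℂ-valued functions towards a
function with values in the Riemann sphere, with respect to the spherical metric. -/
def SphLocUnifConvOn (F : ℕ → ℂ → ℂ) (g : ℂ → Option ℂ) (U : Set ℂ) : Prop :=
  ∀ K : Set ℂ, K ⊆ U → IsCompact K → ∀ ε : ℝ, 0 < ε →
    ∀ᶠ n in atTop, ∀ z ∈ K, chordalDist (some (F n z)) (g z) < ε

/-- The Fatou set: points having a neighborhood on which every sequence of iterates has a
subsequence converging locally uniformly with respect to the spherical metric. -/
def fatouSet (f : ℂ → ℂ) : Set ℂ :=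
  {z | ∃ U ∈ 𝓝 z, ∀ φ : ℕ → ℕ, StrictMono φ →
    ∃ ψ : ℕ → ℕ, StrictMono ψ ∧ ∃ g : ℂ → Option ℂ,
      SphLocUnifConvOn (fun n => f^[φ (ψ n)]) g U}

/-- The Julia set. -/
def juliaSet (f : ℂ → ℂ) : Set ℂ := (fatouSet f)ᶜ

/-- The escaping set. -/
def escapingSet (f : ℂ → ℂ) : Set ℂ :=
  {z | Tendsto (fun n => ‖f^[n] z‖) atTop atTop}

/-- The Fatou set has no multiply connected component. -/
def NoMultiplyConnectedFatouComponent (f : ℂ → ℂ) : Prop :=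
  ∀ z ∈ fatouSet f, SimplyConnectedSpace (connectedComponentIn (fatouSet f) z)

/-- Maximum modulus M(r,f). -/
noncomputable def maxMod (f : ℂ → ℂ) (r : ℝ) : ℝ :=
  sSup ((fun z => ‖f z‖) '' {z : ℂ | ‖z‖ = r})

/-- The order ρ(f) of an entire function, as an extended real number. -/
noncomputable def entireOrder (f : ℂ → ℂ) : EReal :=
  limsup (fun r : ℝ => ((Real.log (Real.log (maxMod f r)) / Real.log r : ℝ) : EReal)) atTop

/-- The fast escaping set A(f). -/
def fastEscapingSet (f : ℂ → ℂ) : Set ℂ :=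
  {z | ∃ R : ℝ, 0 < R ∧ (∀ r : ℝ, R ≤ r → r < maxMod f r) ∧
    ∃ L : ℕ, ∀ n : ℕ, L < n → (maxMod f)^[n - L] R ≤ ‖f^[n] z‖}

/-- `f` is a transcendental entire function. -/
def TranscendentalEntire (f : ℂ → ℂ) : Prop :=
  Differentiable ℂ f ∧ ¬ ∃ p : Polynomial ℂ, ∀ z, f z = p.eval z

/-- Order of vanishing of `g` at `z` (the least `k` with nonzero `k`-th derivative). -/
noncomputable def vanishingOrder (g : ℂ → ℂ) (z : ℂ) : ℕ :=
  sInf {k : ℕ | iteratedDeriv k g z ≠ 0}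

/-- n(r,a): the number of solutions of f(z) = a with |z| ≤ r, counted with multiplicity. -/
noncomputable def nCount (f : ℂ → ℂ) (a : ℂ) (r : ℝ) : ℕ :=
  ∑ᶠ z ∈ {z : ℂ | ‖z‖ ≤ r ∧ f z = a}, vanishingOrder (fun w => f w - a) z

/-- n(r) = max over a of n(r,a). -/
noncomputable def nMax (f : ℂ → ℂ) (r : ℝ) : ℕ := ⨆ a : ℂ, nCount f a r

/-- Critical values of `f`. -/
def criticalValues (f : ℂ → ℂ) : Set ℂ := {w | ∃ z, deriv f z = 0 ∧ f z = w}

/-- Finite asymptotic values of `f`. -/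
def asymptoticValues (f : ℂ → ℂ) : Set ℂ :=
  {w | ∃ γ : ℝ → ℂ, Continuous γ ∧ Tendsto (fun t => ‖γ t‖) atTop atTop ∧
    Tendsto (fun t => f (γ t)) atTop (𝓝 w)}

/-- The Eremenko–Lyubich class B. -/
def ELClass (f : ℂ → ℂ) : Prop :=
  TranscendentalEntire f ∧ Bornology.IsBounded (criticalValues f ∪ asymptoticValues f)

/-- Semihyperbolic polynomial. -/
def SemiHyperbolic (p : Polynomial ℂ) : Prop :=
  ∃ ε : ℝ, 0 < ε ∧ ∃ N : ℕ, ∀ z ∈ juliaSet (fun w => p.eval w), ∀ n : ℕ, 1 ≤ n →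
    ∀ V : Set ℂ, (∃ u ∈ (fun w => p.eval w)^[n] ⁻¹' ball z ε,
        V = connectedComponentIn ((fun w => p.eval w)^[n] ⁻¹' ball z ε) u) →
      ∀ w ∈ ball z ε,
        (∑ᶠ u ∈ {u : ℂ | u ∈ V ∧ (fun v => p.eval v)^[n] u = w},
          vanishingOrder (fun ζ => (fun v => p.eval v)^[n] ζ - w) u) ≤ N

section PathLifting

variable {E X : Type*} [TopologicalSpace E] [TopologicalSpace X] {p : E → X} {c : ℝ → X} {e₀ : E}

/-- `γ` is a continuous lift of `c` along `p` on the set `s`, starting from `e₀` at time `0`. -/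
def IsPathLiftOn (p : E → X) (c : ℝ → X) (e₀ : E) (γ : ℝ → E) (s : Set ℝ) : Prop :=
  ContinuousOn γ s ∧ γ 0 = e₀ ∧ ∀ t ∈ s, p (γ t) = c t

lemma IsPathLiftOn.extend {γ : ℝ → E} {a b : ℝ} (h : IsPathLiftOn p c e₀ γ (Icc 0 a))
    (hc : Continuous c) (ha : 0 ≤ a) (q : OpenPartialHomeomorph E X) (hq : p = q)
    (hγ : γ a ∈ q.source) (hcq : ∀ t ∈ Icc a b, c t ∈ q.target) :
    ∃ γ', IsPathLiftOn p c e₀ γ' (Icc 0 b) := by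
  classical
  refine ⟨fun t => if t ≤ a then γ t else q.symm (c t), ?_, ?_, ?_⟩
  · apply ContinuousOn.if
    · intro t ht
      have hta : t = a := by
        have := ht.2
        rw [show {t : ℝ | t ≤ a} = Iic a from rfl, frontier_Iic] at this
        exact this
      subst hta
      have h1 : c t = q (γ t) := by rw [← hq]; exact (h.2.2 t ⟨ha, le_rfl⟩).symm
      rw [h1, q.left_inv hγ]
    · apply h.1.mono
      rintro t ⟨h1, h2⟩
      rw [show {t : ℝ | t ≤ a} = Iic a from rfl, closure_Iic] at h2
      exact ⟨h1.1, h2⟩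
    · apply q.continuousOn_symm.comp hc.continuousOn
      rintro t ⟨h1, h2⟩
      have h3 : t ∈ closure (Ioi a) := by
        convert h2 using 2
        ext; simp
      rw [closure_Ioi] at h3
      exact hcq t ⟨h3, h1.2⟩
  · simp [ha, h.2.1]
  · intro t ht
    by_cases hta : t ≤ a
    · simp [hta, h.2.2 t ⟨ht.1, hta⟩]
    · simp only [hta, if_false]
      rw [hq]
      exact q.right_inv (hcq t ⟨(not_le.1 hta).le, ht.2⟩)

/-- Path lifting for a separated local homeomorphism, provided that partial lifts accumulate
at their terminal time. -/
lemma IsLocalHomeomorph.exists_isPathLiftOn [T2Space E] [T2Space X]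
    (hp : IsLocalHomeomorph p) (hc : Continuous c) (h0 : p e₀ = c 0)
    (hacc : ∀ T > 0, ∀ γ, IsPathLiftOn p c e₀ γ (Ico 0 T) → ∃ e, MapClusterPt e (𝓝[<] T) γ)
    (b : ℝ) : ∃ γ, IsPathLiftOn p c e₀ γ (Icc 0 b) := by
  by_contra hb
  set S : Set ℝ := {t | 0 ≤ t ∧ ∃ γ, IsPathLiftOn p c e₀ γ (Icc 0 t)} with hS
  have down : ∀ s t, 0 ≤ s → s ≤ t → t ∈ S → s ∈ S := by
    rintro s t hs hst ⟨-, γ, hγ⟩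
    exact ⟨hs, γ, hγ.1.mono (Icc_subset_Icc_right hst), hγ.2.1,
      fun u hu => hγ.2.2 u (Icc_subset_Icc_right hst hu)⟩
  have bdd : ∀ t ∈ S, t < b := by
    intro t ht
    by_contra! hbt
    rcases lt_or_ge b 0 with hb0 | hb0
    · exact hb ⟨fun _ => e₀, continuousOn_const, rfl, fun t ht => by
        exact absurd (ht.1.trans ht.2) (not_le.2 hb0)⟩
    · exact hb (down b t hb0 hbt ht).2
  have zero : (0 : ℝ) ∈ S := by
    refine ⟨le_rfl, fun _ => e₀, continuousOn_const, rfl, fun t ht => ?_⟩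
    rw [show t = 0 from le_antisymm ht.2 ht.1, h0]
  have hbdd : BddAbove S := ⟨b, fun t ht => (bdd t ht).le⟩
  have window : ∀ (T : ℝ) (e : E), p e = c T → ∃ δ > 0, ∃ U ∈ 𝓝 e, ∀ s ∈ Ioo (T - δ) (T + δ),
      0 ≤ s → ∀ γ, IsPathLiftOn p c e₀ γ (Icc 0 s) → γ s ∈ U → T + δ / 2 ∈ S ∨ T + δ / 2 < 0 := by
    intro T e he
    obtain ⟨q, hq, hpq⟩ := hp e
    have h1 : ∀ᶠ t in 𝓝 T, c t ∈ q.target := by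
      apply hc.continuousAt.eventually
      apply q.open_target.mem_nhds
      rw [← he, hpq]
      exact q.map_source hq
    obtain ⟨δ, hδ, hball⟩ := Metric.eventually_nhds_iff.1 h1
    refine ⟨δ, hδ, q.source, q.open_source.mem_nhds hq, fun s hs hs0 γ hγ hU => ?_⟩
    by_cases hneg : T + δ / 2 < 0
    · exact Or.inr hneg
    · refine Or.inl ⟨not_lt.1 hneg, hγ.extend hc hs0 q hpq hU fun t ht => hball ?_⟩
      rw [Real.dist_eq, abs_lt]
      constructor <;> linarith [ht.1, ht.2, hs.1, hs.2]
  set T := sSup S with hT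
  have hT0 : 0 ≤ T := le_csSup hbdd zero
  have contra : ∀ δ > 0, ¬ (T + δ / 2 ∈ S ∨ T + δ / 2 < 0) := by
    rintro δ hδ (h | h)
    · linarith [le_csSup hbdd h]
    · linarith
  rcases hT0.eq_or_lt with hT0 | hT0
  · obtain ⟨-, γ, hγ⟩ := zero
    obtain ⟨δ, hδ, U, hU, h⟩ := window T e₀ (by rw [← hT0, h0])
    refine contra δ hδ (h 0 ⟨by linarith, by linarith⟩ le_rfl γ hγ ?_)
    rw [hγ.2.1]
    exact mem_of_mem_nhds hU
  · have memS : ∀ s, 0 ≤ s → s < T → s ∈ S := by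
      intro s hs hsT
      obtain ⟨t, ht, hst⟩ := exists_lt_of_lt_csSup ⟨0, zero⟩ hsT
      exact down s t hs hst.le ht
    have ex : ∀ s, ∃ γ, 0 ≤ s → s < T → IsPathLiftOn p c e₀ γ (Icc 0 s) := by
      intro s
      by_cases hs : 0 ≤ s ∧ s < T
      · obtain ⟨-, γ, hγ⟩ := memS s hs.1 hs.2
        exact ⟨γ, fun _ _ => hγ⟩
      · exact ⟨fun _ => e₀, fun h1 h2 => absurd ⟨h1, h2⟩ hs⟩
    choose g hg using ex
    have agree : ∀ s t, 0 ≤ s → s ≤ t → t < T → g s s = g t s := by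
      intro s t hs hst htT
      have hs' := hg s hs (hst.trans_lt htT)
      have ht' := hg t (hs.trans hst) htT
      refine (T2Space.isSeparatedMap p).eqOn_of_comp_eqOn hp.isLocallyInjective isPreconnected_Icc
        hs'.1 (ht'.1.mono (Icc_subset_Icc_right hst)) (fun u hu => ?_) (a := 0) ⟨le_rfl, hs⟩
        (hs'.2.1.trans ht'.2.1.symm) ⟨hs, le_rfl⟩
      simp only [Function.comp]
      rw [hs'.2.2 u hu, ht'.2.2 u (Icc_subset_Icc_right hst hu)]
    set Γ : ℝ → E := fun s => g s s with hΓ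
    have liftΓ : ∀ t, 0 ≤ t → t < T → IsPathLiftOn p c e₀ Γ (Icc 0 t) := by
      intro t ht htT
      have h := hg t ht htT
      have heq : EqOn Γ (g t) (Icc 0 t) := fun s hs => agree s t hs.1 hs.2 htT
      exact ⟨h.1.congr heq, (heq ⟨le_rfl, ht⟩).trans h.2.1,
        fun s hs => by rw [heq hs]; exact h.2.2 s hs⟩
    have liftT : IsPathLiftOn p c e₀ Γ (Ico 0 T) := by
      refine ⟨fun t ht => ?_, (liftΓ 0 le_rfl hT0).2.1,
        fun t ht => (liftΓ t ht.1 ht.2).2.2 t ⟨ht.1, le_rfl⟩⟩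
      obtain ⟨t', h1, h2⟩ := exists_between ht.2
      have := (liftΓ t' (ht.1.trans h1.le) h2).1 t ⟨ht.1, h1.le⟩
      refine this.mono_of_mem_nhdsWithin ?_
      filter_upwards [self_mem_nhdsWithin, mem_nhdsWithin_of_mem_nhds (Iio_mem_nhds h1)]
        with u hu hu'
      exact ⟨hu.1, le_of_lt hu'⟩
    obtain ⟨e, he⟩ := hacc T hT0 Γ liftT
    have hIco : ∀ᶠ t in 𝓝[<] T, t ∈ Ico 0 T := Ico_mem_nhdsLT hT0
    have hpe : p e = c T := by
      have h1 : MapClusterPt (p e) (𝓝[<] T) (p ∘ Γ) :=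
        he.continuousAt_comp hp.continuous.continuousAt
      have h2 : Tendsto (p ∘ Γ) (𝓝[<] T) (𝓝 (c T)) := by
        refine ((hc.tendsto T).mono_left nhdsWithin_le_nhds).congr' ?_
        filter_upwards [hIco] with t ht
        exact (liftT.2.2 t ht).symm
      exact eq_of_nhds_neBot (ClusterPt.mono h1 h2)
    obtain ⟨δ, hδ, U, hU, h⟩ := window T e hpe
    have hfr : ∃ᶠ t in 𝓝[<] T, Γ t ∈ U := he.frequently hU
    have hev : ∀ᶠ t in 𝓝[<] T, t ∈ Ioo (T - δ) (T + δ) :=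
      mem_nhdsWithin_of_mem_nhds (Ioo_mem_nhds (by linarith) (by linarith))
    obtain ⟨s, hsU, hs1, hs2⟩ := (hfr.and_eventually (hev.and hIco)).exists
    exact contra δ hδ (h s hs1 hs2.1 Γ (liftΓ s hs2.1 hs2.2) hsU)

end PathLifting

section InverseBranch

variable {f : ℂ → ℂ} {R₀ : ℝ}

/-- All critical and asymptotic values of `f` lie in the closed disc of radius `R₀`. -/
def SingularValuesLE (f : ℂ → ℂ) (R₀ : ℝ) : Prop :=
  ∀ w ∈ criticalValues f ∪ asymptoticValues f, ‖w‖ ≤ R₀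

lemma SingularValuesLE.deriv_ne_zero (hs : SingularValuesLE f R₀) {z : ℂ} (hz : R₀ < ‖f z‖) :
    deriv f z ≠ 0 := fun h => absurd (hs (f z) (Or.inl ⟨z, h, rfl⟩)) (not_le.2 hz)

lemma isLocalHomeomorph_restrict (hf : Differentiable ℂ f) (hs : SingularValuesLE f R₀) :
    IsLocalHomeomorph (fun z : {z : ℂ // R₀ < ‖f z‖} => f z) := by
  have hopen : IsOpen {z : ℂ | R₀ < ‖f z‖} := isOpen_lt continuous_const hf.continuous.norm
  have h1 : IsLocalHomeomorphOn f {z : ℂ | R₀ < ‖f z‖} := by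
    intro z hz
    have hd : HasStrictDerivAt f (deriv f z) z := (hf.analyticAt z).hasStrictDerivAt
    exact ⟨_, (hd.hasStrictFDerivAt_equiv (hs.deriv_ne_zero hz)).mem_toOpenPartialHomeomorph_source,
      by simp⟩
  have h2 : IsLocalHomeomorph (Subtype.val : {z : ℂ // R₀ < ‖f z‖} → ℂ) :=
    hopen.isOpenEmbedding_subtypeVal.isLocalHomeomorph
  rw [isLocalHomeomorph_iff_isLocalHomeomorphOn_univ] at h2 ⊢
  exact h1.comp h2 fun z _ => z.2

lemma exists_mapClusterPt_of_isPathLiftOn (hf : Differentiable ℂ f) (hs : SingularValuesLE f R₀)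
    {c : ℝ → ℂ} (hc : Continuous c) (hcR : ∀ t, R₀ < ‖c t‖) {e₀ : {z : ℂ // R₀ < ‖f z‖}}
    {T : ℝ} (hT : 0 < T) {γ : ℝ → {z : ℂ // R₀ < ‖f z‖}}
    (hγ : IsPathLiftOn (fun z : {z : ℂ // R₀ < ‖f z‖} => f z) c e₀ γ (Ico 0 T)) :
    ∃ e, MapClusterPt e (𝓝[<] T) γ := by
  have hIco : ∀ᶠ t in 𝓝[<] T, t ∈ Ico 0 T := Ico_mem_nhdsLT hT
  have hlim : Tendsto (fun t => f (γ t)) (𝓝[<] T) (𝓝 (c T)) := by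
    refine ((hc.tendsto T).mono_left nhdsWithin_le_nhds).congr' ?_
    filter_upwards [hIco] with t ht
    exact (hγ.2.2 t ht).symm
  by_cases htend : Tendsto (fun t => ‖(γ t : ℂ)‖) (𝓝[<] T) atTop
  · exfalso
    set u : ℝ → ℝ := fun s => T * (1 - (1 + max s 0)⁻¹) with hu
    have hpos : ∀ s : ℝ, 0 < 1 + max s 0 := fun s => by positivity
    have hucont : Continuous u := by
      refine continuous_const.mul (continuous_const.sub (Continuous.inv₀ (by fun_prop) ?_))
      exact fun s => (hpos s).ne'
    have humem : ∀ s, u s ∈ Ico 0 T := by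
      intro s
      have h1 : (1 + max s 0)⁻¹ ≤ 1 := inv_le_one_of_one_le₀ (by simp)
      have h2 : 0 < (1 + max s 0)⁻¹ := inv_pos.2 (hpos s)
      constructor
      · exact mul_nonneg hT.le (by linarith)
      · simp only [hu]; nlinarith
    have hutend : Tendsto u atTop (𝓝[<] T) := by
      refine tendsto_nhdsWithin_iff.2 ⟨?_, Eventually.of_forall fun s => (humem s).2⟩
      have h1 : Tendsto (fun s : ℝ => 1 + max s 0) atTop atTop :=
        tendsto_atTop_mono (fun s => by simp only [id]; linarith [le_max_left s 0]) tendsto_id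
      have h2 := (tendsto_const_nhds (x := (1 : ℝ))).sub (tendsto_inv_atTop_zero.comp h1)
      have h3 := (tendsto_const_nhds (x := T)).mul h2
      simpa [hu] using h3
    have hasym : c T ∈ asymptoticValues f := by
      refine ⟨fun s => (γ (u s) : ℂ), ?_, htend.comp hutend, hlim.comp hutend⟩
      exact continuous_subtype_val.comp (hγ.1.comp_continuous hucont humem)
    exact absurd (hs _ (Or.inr hasym)) (not_le.2 (hcR T))
  · obtain ⟨B, hB⟩ := not_forall.1 (fun h => htend (tendsto_atTop.2 h))
    have hfr : ∃ᶠ t in 𝓝[<] T, (γ t : ℂ) ∈ closedBall (0 : ℂ) B := by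
      refine (not_eventually.1 hB).mono fun t ht => ?_
      simpa using (not_le.1 ht).le
    obtain ⟨z, -, hz⟩ := (isCompact_closedBall (0 : ℂ) B).exists_mapClusterPt_of_frequently hfr
    have hfz : f z = c T := by
      have h1 : MapClusterPt (f z) (𝓝[<] T) (fun t => f (γ t)) :=
        hz.continuousAt_comp hf.continuous.continuousAt
      exact eq_of_nhds_neBot (ClusterPt.mono h1 hlim)
    refine ⟨⟨z, by rw [hfz]; exact hcR T⟩, ?_⟩
    refine mapClusterPt_iff_frequently.2 fun s hs => ?_
    obtain ⟨t, ht, hts⟩ := mem_nhds_subtype _ _ _ |>.1 hs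
    exact (mapClusterPt_iff_frequently.1 hz t ht).mono fun x hx => hts hx

/-- A continuous solution of `f ∘ G = exp` is holomorphic where `f` is locally injective. -/
lemma hasDerivAt_of_comp_eq_exp (hf : Differentiable ℂ f) {G : ℂ → ℂ} {ζ : ℂ}
    (hG : ContinuousAt G ζ) (hfG : ∀ᶠ ξ in 𝓝 ζ, f (G ξ) = Complex.exp ξ)
    (hd : deriv f (G ζ) ≠ 0) :
    HasDerivAt G (f (G ζ) / deriv f (G ζ)) ζ := by
  set L : ℂ → ℂ := fun z => Complex.log (f z * Complex.exp (-ζ)) + ζ with hL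
  have hval : f (G ζ) * Complex.exp (-ζ) = 1 := by
    rw [hfG.self_of_nhds, ← Complex.exp_add]; simp
  have hne : f (G ζ) ≠ 0 := by rw [hfG.self_of_nhds]; exact Complex.exp_ne_zero _
  have h1 : HasDerivAt L (deriv f (G ζ) / f (G ζ)) (G ζ) := by
    have := (((hf (G ζ)).hasDerivAt.mul_const (Complex.exp (-ζ))).clog
      (by rw [hval]; exact Complex.one_mem_slitPlane)).add_const ζ
    refine this.congr_deriv ?_
    rw [hfG.self_of_nhds]
    have := Complex.exp_ne_zero (-ζ)
    field_simp
  have h2 := HasDerivAt.of_local_left_inverse (g := G) (a := ζ) hG h1 (div_ne_zero hd hne) (by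
    have hnear : ∀ᶠ ξ in 𝓝 ζ, ‖ξ - ζ‖ < 1 := by
      have : ball ζ 1 ∈ 𝓝 ζ := ball_mem_nhds _ one_pos
      filter_upwards [this] with ξ hξ
      rwa [← dist_eq_norm]
    filter_upwards [hfG, hnear] with ξ h1 h2
    have him : |(ξ - ζ).im| < 1 := (Complex.abs_im_le_norm _).trans_lt h2
    rw [abs_lt] at him
    simp only [hL]
    rw [h1, ← Complex.exp_add, ← sub_eq_add_neg, Complex.log_exp]
    · ring
    · linarith [Real.pi_gt_three]
    · linarith [Real.pi_gt_three])
  exact h2.congr_deriv (inv_div _ _)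

lemma log_lt_re_iff_exp {R : ℝ} (hR : 0 < R) {ζ : ℂ} :
    Real.log R < ζ.re ↔ R < ‖Complex.exp ζ‖ := by
  rw [Complex.norm_exp, Real.log_lt_iff_lt_exp hR]

/-- In logarithmic coordinates, an inverse branch of a function in the Eremenko-Lyubich class
extends to a half-plane. -/
lemma exists_inverse_branch (hf : Differentiable ℂ f) (hs : SingularValuesLE f R₀) (hR : 0 < R₀)
    {z₀ ζ₀ : ℂ} (h0 : f z₀ = Complex.exp ζ₀) (hζ₀ : Real.log R₀ < ζ₀.re) :
    ∃ G : ℂ → ℂ, G ζ₀ = z₀ ∧ ∀ ζ : ℂ, Real.log R₀ < ζ.re → f (G ζ) = Complex.exp ζ ∧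
      HasDerivAt G (f (G ζ) / deriv f (G ζ)) ζ := by
  have hhom := isLocalHomeomorph_restrict hf hs
  set p : {z : ℂ // R₀ < ‖f z‖} → ℂ := fun z => f z with hp
  have hz₀ : R₀ < ‖f z₀‖ := by rw [h0]; exact (log_lt_re_iff_exp hR).1 hζ₀
  set e₀ : {z : ℂ // R₀ < ‖f z‖} := ⟨z₀, hz₀⟩
  set cl : ℝ → ℝ := fun t => max 0 (min t 1) with hcl
  have hcl_cont : Continuous cl := by fun_prop
  have hcl01 : ∀ t, 0 ≤ cl t ∧ cl t ≤ 1 := fun t => by simp [hcl]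
  set seg : ℝ → ℂ → ℂ := fun t ζ => ζ₀ + (cl t : ℂ) * (ζ - ζ₀) with hseg
  have hseg_re : ∀ t (ζ : {ζ : ℂ // Real.log R₀ < ζ.re}), Real.log R₀ < (seg t ζ).re := by
    intro t ζ
    have h1 := ζ.2
    obtain ⟨h2, h3⟩ := hcl01 t
    have : (seg t ζ).re = ζ₀.re + cl t * ((ζ : ℂ).re - ζ₀.re) := by simp [hseg]
    rw [this]
    rcases h3.eq_or_lt with h3 | h3
    · rw [h3]; linarith
    · nlinarith [mul_nonneg h2 (sub_nonneg.2 h1.le), mul_pos (sub_pos.2 h3) (sub_pos.2 hζ₀)]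
  have hex : ∀ ζ : {ζ : ℂ // Real.log R₀ < ζ.re}, ∃ γ, IsPathLiftOn p (fun t => Complex.exp (seg t ζ)) e₀ γ (Icc 0 1) := by
    intro ζ
    have hc : Continuous fun t => Complex.exp (seg t ζ) := by fun_prop
    refine hhom.exists_isPathLiftOn hc ?_ (fun T hT γ hγ => ?_) 1
    · simp [hseg, hcl, hp, e₀, h0]
    · exact exists_mapClusterPt_of_isPathLiftOn hf hs hc
        (fun t => (log_lt_re_iff_exp hR).1 (hseg_re t ζ)) hT hγ
  choose Γ hΓ using hex
  have hcont : Continuous fun x : unitInterval × {ζ : ℂ // Real.log R₀ < ζ.re} => Γ x.2 x.1 := by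
    refine hhom.continuous_lift (T2Space.isSeparatedMap p)
      ⟨fun x : unitInterval × {ζ : ℂ // Real.log R₀ < ζ.re} => Complex.exp (seg x.1 x.2), by fun_prop⟩
      (g := fun x => Γ x.2 x.1) ?_ ?_ ?_
    · ext x
      exact (hΓ x.2).2.2 x.1 x.1.2
    · refine (continuous_const (y := e₀)).congr fun a => ?_
      exact (hΓ a).2.1.symm
    · intro a
      exact (hΓ a).1.comp_continuous continuous_subtype_val fun t => t.2
  set G' : {ζ : ℂ // Real.log R₀ < ζ.re} → ℂ := fun ζ => (Γ ζ 1 : ℂ) with hG'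
  have hG'cont : Continuous G' :=
    continuous_subtype_val.comp (hcont.comp (Continuous.prodMk_right (1 : unitInterval)))
  have hG'f : ∀ ζ : {ζ : ℂ // Real.log R₀ < ζ.re}, f (G' ζ) = Complex.exp ζ := by
    intro ζ
    have := (hΓ ζ).2.2 1 ⟨zero_le_one, le_rfl⟩
    simpa [hp, hseg, hcl] using this
  have hopen : IsOpen {ζ : ℂ | Real.log R₀ < ζ.re} := isOpen_lt continuous_const Complex.continuous_re
  classical
  set G : ℂ → ℂ := fun ζ => if h : Real.log R₀ < ζ.re then G' ⟨ζ, h⟩ else 0 with hG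
  have hGf : ∀ ζ : ℂ, Real.log R₀ < ζ.re → f (G ζ) = Complex.exp ζ := by
    intro ζ hζ
    simp only [hG, dif_pos hζ]
    exact hG'f ⟨ζ, hζ⟩
  refine ⟨G, ?_, fun ζ hζ => ⟨hGf ζ hζ, ?_⟩⟩
  · simp only [hG, dif_pos hζ₀, hG']
    have h1 : (Γ ⟨ζ₀, hζ₀⟩ 1) = (Γ ⟨ζ₀, hζ₀⟩ 0) := by
      refine (T2Space.isSeparatedMap p).constOn_of_comp hhom.isLocallyInjective
        isPreconnected_Icc (hΓ ⟨ζ₀, hζ₀⟩).1 (fun a ha a' ha' => ?_)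
        (⟨zero_le_one, le_rfl⟩ : (1 : ℝ) ∈ Icc 0 1) ⟨le_rfl, zero_le_one⟩
      rw [(hΓ ⟨ζ₀, hζ₀⟩).2.2 a ha, (hΓ ⟨ζ₀, hζ₀⟩).2.2 a' ha']
      simp [hseg]
    rw [h1, (hΓ ⟨ζ₀, hζ₀⟩).2.1]
  · have hnhds := hopen.mem_nhds hζ
    refine hasDerivAt_of_comp_eq_exp hf ?_ (by filter_upwards [hnhds] with ξ hξ using hGf ξ hξ) ?_
    · have h1 : ContinuousOn G {ζ : ℂ | Real.log R₀ < ζ.re} := by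
        rw [continuousOn_iff_continuous_domRestrict]
        refine hG'cont.congr fun x => ?_
        simp only [Set.domRestrict_apply, hG]
        rw [dif_pos x.2]
      exact h1.continuousAt hnhds
    · apply hs.deriv_ne_zero
      rw [hGf ζ hζ]
      exact (log_lt_re_iff_exp hR).1 hζ

end InverseBranch

section ZeroCounting

lemma exists_eq_prod_sub_mul {g : ℂ → ℂ} (hg : Differentiable ℂ g) (S : Finset ℂ)
    (hS : ∀ a ∈ S, g a = 0) :
    ∃ h : ℂ → ℂ, Differentiable ℂ h ∧ ∀ z, g z = (∏ a ∈ S, (z - a)) * h z := by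
  classical
  induction S using Finset.induction_on with
  | empty => exact ⟨g, hg, by simp⟩
  | insert b S hb ih =>
    obtain ⟨h, hh, hgh⟩ := ih fun a ha => hS a (Finset.mem_insert_of_mem ha)
    have hhb : h b = 0 := by
      have h1 := hgh b
      rw [hS b (Finset.mem_insert_self b S)] at h1
      refine (mul_eq_zero.1 h1.symm).resolve_left ?_
      refine Finset.prod_ne_zero_iff.2 fun a ha => sub_ne_zero.2 ?_
      rintro rfl
      exact hb ha
    refine ⟨dslope h b, ?_, fun z => ?_⟩
    · rw [← differentiableOn_univ] at hh ⊢
      exact (Complex.differentiableOn_dslope univ_mem).2 hh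
    · have h2 := sub_smul_dslope h b z
      rw [hhb, sub_zero, smul_eq_mul] at h2
      rw [hgh z, Finset.prod_insert hb, ← h2]
      ring

/-- A bound for the number of solutions of `f z = w` in a disc in terms of the maximum modulus. -/
lemma two_pow_card_mul_norm_sub_le {f : ℂ → ℂ} (hf : Differentiable ℂ f) {r M : ℝ} (hr : 0 < r)
    (hM : ∀ z, ‖z‖ = 3 * r → ‖f z‖ ≤ M) {w : ℂ} (S : Finset ℂ)
    (hS : ∀ z ∈ S, ‖z‖ ≤ r ∧ f z = w) : 2 ^ S.card * ‖f 0 - w‖ ≤ M + ‖w‖ := by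
  obtain ⟨h, hh, hfh⟩ := exists_eq_prod_sub_mul (hf.sub_const w) S
    fun a ha => sub_eq_zero.2 (hS a ha).2
  have hbd : ∀ z ∈ frontier (ball (0 : ℂ) (3 * r)), ‖h z‖ ≤ (M + ‖w‖) / (2 * r) ^ S.card := by
    intro z hz
    rw [frontier_ball _ (by positivity), mem_sphere_zero_iff_norm] at hz
    have h1 : ‖f z - w‖ ≤ M + ‖w‖ := (norm_sub_le _ _).trans (by gcongr; exact hM z hz)
    have h2 : (2 * r) ^ S.card ≤ ‖∏ a ∈ S, (z - a)‖ := by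
      rw [norm_prod, ← Finset.prod_const]
      refine Finset.prod_le_prod (fun _ _ => by positivity) fun a ha => ?_
      have := norm_sub_norm_le z a
      linarith [(hS a ha).1]
    rw [le_div_iff₀ (by positivity)]
    calc ‖h z‖ * (2 * r) ^ S.card ≤ ‖h z‖ * ‖∏ a ∈ S, (z - a)‖ := by gcongr
      _ = ‖f z - w‖ := by rw [hfh z, norm_mul, mul_comm]
      _ ≤ _ := h1
  have h0 := Complex.norm_le_of_forall_mem_frontier_norm_le isBounded_ball hh.diffContOnCl hbd
    (subset_closure (mem_ball_self (by positivity : 0 < 3 * r)))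
  have h3 : ‖∏ a ∈ S, ((0 : ℂ) - a)‖ ≤ r ^ S.card := by
    rw [norm_prod, ← Finset.prod_const]
    refine Finset.prod_le_prod (fun _ _ => norm_nonneg _) fun a ha => ?_
    simpa using (hS a ha).1
  rw [le_div_iff₀ (by positivity), mul_pow] at h0
  calc 2 ^ S.card * ‖f 0 - w‖ = 2 ^ S.card * (‖∏ a ∈ S, ((0 : ℂ) - a)‖ * ‖h 0‖) := by
        rw [hfh 0, norm_mul]
    _ ≤ 2 ^ S.card * (r ^ S.card * ‖h 0‖) := by gcongr
    _ = ‖h 0‖ * (2 ^ S.card * r ^ S.card) := by ring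
    _ ≤ _ := h0

lemma exists_polynomial_of_frequently_norm_le_pow {f : ℂ → ℂ} (hf : Differentiable ℂ f) {C : ℝ}
    {n : ℕ} (h : ∃ᶠ r : ℝ in atTop, ∀ z, ‖z‖ = r → ‖f z‖ ≤ C * r ^ n) :
    ∃ p : Polynomial ℂ, ∀ z, f z = p.eval z := by
  have hz : ∀ k, n < k → iteratedDeriv k f 0 = 0 := by
    intro k hk
    have hev : ∃ᶠ R : ℝ in atTop, ‖iteratedDeriv k f 0‖ ≤ k.factorial * C * (R⁻¹) ^ (k - n) := by
      refine (h.and_eventually (eventually_gt_atTop 0)).mono fun R hR => ?_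
      have hR0 := hR.2
      have h1 := Complex.norm_iteratedDeriv_le_of_forall_mem_sphere_norm_le k hR0
        (hf.diffContOnCl (s := ball (0 : ℂ) R)) (C := C * R ^ n)
        (fun z hz => hR.1 z (mem_sphere_zero_iff_norm.1 hz))
      refine h1.trans (le_of_eq ?_)
      have : R ^ k = R ^ n * R ^ (k - n) := by rw [← pow_add]; congr 1; omega
      rw [this, inv_pow]; field_simp
    have hlim : Tendsto (fun R : ℝ => k.factorial * C * (R⁻¹) ^ (k - n)) atTop (𝓝 0) := by
      have := (tendsto_inv_atTop_zero (𝕜 := ℝ)).pow (k - n)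
      rw [zero_pow (by omega)] at this
      simpa using this.const_mul (k.factorial * C)
    exact norm_le_zero_iff.1 (ge_of_tendsto_of_frequently hlim hev)
  refine ⟨∑ k ∈ Finset.range (n + 1), Polynomial.monomial k
    ((k.factorial : ℂ)⁻¹ * iteratedDeriv k f 0), fun z => ?_⟩
  rw [← (Complex.hasSum_taylorSeries_of_entire hf 0 z).tsum_eq,
    tsum_eq_sum (s := Finset.range (n + 1)), Polynomial.eval_finsetSum]
  · refine Finset.sum_congr rfl fun k _ => ?_
    simp; ring
  · intro k hk
    rw [hz k (by simpa using hk)]; simp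

lemma exists_polynomial_of_norm_le_pow {f : ℂ → ℂ} (hf : Differentiable ℂ f) {C ρ : ℝ} {n : ℕ}
    (h : ∀ z, ρ ≤ ‖z‖ → ‖f z‖ ≤ C * ‖z‖ ^ n) : ∃ p : Polynomial ℂ, ∀ z, f z = p.eval z := by
  refine exists_polynomial_of_frequently_norm_le_pow hf (C := C) (n := n)
    ((eventually_ge_atTop ρ).mono fun r hr z hz => ?_).frequently
  rw [← hz]
  exact h z (by rwa [hz])

/-- An entire function that is bounded away from zero outside a disc is a polynomial. -/
lemma exists_polynomial_of_le_norm {f : ℂ → ℂ} (hf : Differentiable ℂ f) {c ρ : ℝ} (hc : 0 < c)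
    (h : ∀ z, ρ ≤ ‖z‖ → c ≤ ‖f z‖) : ∃ p : Polynomial ℂ, ∀ z, f z = p.eval z := by
  set δ : ℝ := (max ρ 1)⁻¹ with hδ
  have hδ0 : 0 < δ := by positivity
  have hge : ∀ u : ℂ, u ≠ 0 → ‖u‖ < δ → ρ ≤ ‖u⁻¹‖ := by
    intro u hu hud
    rw [norm_inv]
    refine (le_max_left ρ 1).trans ?_
    rw [le_inv_comm₀ (by positivity) (norm_pos_iff.2 hu)]
    exact hud.le
  have hne : ∀ u : ℂ, u ≠ 0 → ‖u‖ < δ → f u⁻¹ ≠ 0 := fun u hu hud =>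
    norm_pos_iff.1 (hc.trans_le (h _ (hge u hu hud)))
  set k : ℂ → ℂ := fun u => (f u⁻¹)⁻¹ with hk
  have hkd : DifferentiableOn ℂ k (ball 0 δ \ {0}) := by
    intro u hu
    have hu0 : u ≠ 0 := hu.2
    have hud : ‖u‖ < δ := by simpa using hu.1
    exact (((hf u⁻¹).comp u (differentiableAt_inv hu0)).inv
      (hne u hu0 hud)).differentiableWithinAt
  have hbd : BddAbove (norm ∘ k '' (ball 0 δ \ {0})) := by
    refine ⟨c⁻¹, ?_⟩
    rintro _ ⟨u, hu, rfl⟩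
    have hu0 : u ≠ 0 := hu.2
    have hud : ‖u‖ < δ := by simpa using hu.1
    simp only [Function.comp, hk, norm_inv]
    exact inv_anti₀ hc (h _ (hge u hu0 hud))
  set K := Function.update k 0 (limUnder (𝓝[≠] 0) k) with hK
  have hKd : DifferentiableOn ℂ K (ball 0 δ) :=
    Complex.differentiableOn_update_limUnder_of_bddAbove (ball_mem_nhds 0 hδ0) hkd hbd
  have hKan : AnalyticAt ℂ K 0 := hKd.analyticAt (ball_mem_nhds 0 hδ0)
  have hKk : ∀ u : ℂ, u ≠ 0 → K u = (f u⁻¹)⁻¹ := fun u hu => by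
    simp [hK, hk, hu]
  have hnz : ¬ ∀ᶠ u in 𝓝 (0 : ℂ), K u = 0 := by
    intro hz
    have h1 : ∀ᶠ u in 𝓝[≠] (0 : ℂ), K u = 0 ∧ ‖u‖ < δ := by
      refine (hz.and ?_).filter_mono nhdsWithin_le_nhds
      filter_upwards [ball_mem_nhds (0 : ℂ) hδ0] with u hu
      simpa using hu
    obtain ⟨u, ⟨hu1, hu2⟩, hu0⟩ := (h1.and self_mem_nhdsWithin).exists
    rw [hKk u hu0, inv_eq_zero] at hu1
    exact hne u hu0 hu2 hu1
  obtain ⟨n, G, hGan, hG0, hG⟩ := hKan.exists_eventuallyEq_pow_smul_nonzero_iff.2 hnz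
  have hGge : ∀ᶠ u in 𝓝 (0 : ℂ), ‖G 0‖ / 2 ≤ ‖G u‖ := by
    have := hGan.continuousAt.norm.tendsto
    refine (this.eventually (lt_mem_nhds (half_lt_self (norm_pos_iff.2 hG0)))).mono fun _ h => h.le
  obtain ⟨η, hη, hηG⟩ := Metric.eventually_nhds_iff.1 (hG.and hGge)
  refine exists_polynomial_of_norm_le_pow hf (C := (‖G 0‖ / 2)⁻¹) (ρ := 2 * η⁻¹) (n := n) ?_
  intro z hz
  have hη' : 0 < η⁻¹ := inv_pos.2 hη
  have hz0 : 0 < ‖z‖ := by linarith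
  have hzne : z ≠ 0 := norm_pos_iff.1 hz0
  obtain ⟨h1, h2⟩ := hηG (y := z⁻¹) (by
    rw [dist_zero_right, norm_inv, inv_lt_comm₀ hz0 hη]; linarith)
  rw [hKk _ (inv_ne_zero hzne), inv_inv, sub_zero, smul_eq_mul] at h1
  have h3 := congrArg norm h1
  rw [norm_inv, norm_mul, norm_pow, norm_inv] at h3
  have hG2 : 0 < ‖G 0‖ / 2 := half_pos (norm_pos_iff.2 hG0)
  rw [← inv_inv ‖f z‖, h3, mul_inv, inv_pow, inv_inv, mul_comm]
  gcongr

end ZeroCounting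

section CircleMinima

variable {f : ℂ → ℂ} {R₀ : ℝ}

lemma TranscendentalEntire.exists_lt_norm (hf : TranscendentalEntire f) (R : ℝ) :
    ∃ z, R < ‖f z‖ := by
  by_contra! h
  exact hf.2 (exists_polynomial_of_norm_le_pow hf.1 (C := R) (ρ := 0) (n := 0)
    fun z _ => by simpa using h z)

lemma isPreconnected_setOf_lt_norm {r : ℝ} (hr : 0 < r) : IsPreconnected {z : ℂ | r < ‖z‖} := by
  have h : {z : ℂ | r < ‖z‖} = Complex.exp '' {ζ : ℂ | Real.log r < ζ.re} := by
    ext z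
    constructor
    · intro hz
      have hz0 : z ≠ 0 := norm_pos_iff.1 (hr.trans hz)
      refine ⟨Complex.log z, ?_, Complex.exp_log hz0⟩
      rw [mem_ofPred_eq, log_lt_re_iff_exp hr, Complex.exp_log hz0]
      exact hz
    · rintro ⟨ζ, hζ, rfl⟩
      exact (log_lt_re_iff_exp hr).1 hζ
  rw [h]
  exact ((convex_halfSpace_re_gt _).isPreconnected).image _ Complex.continuous_exp.continuousOn

/-- If an inverse branch of `f` in logarithmic coordinates is periodic, then `f` is large
outside a disc. -/
lemma exists_polynomial_of_periodic_branch (hf : Differentiable ℂ f) {a : ℝ} {G : ℂ → ℂ}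
    (hG : ∀ ζ : ℂ, a < ζ.re → f (G ζ) = Complex.exp ζ ∧
      HasDerivAt G (f (G ζ) / deriv f (G ζ)) ζ)
    (hd : ∀ ζ : ℂ, a < ζ.re → deriv f (G ζ) ≠ 0)
    {P : ℝ} (hP : 0 < P) (hper : ∀ ζ : ℂ, a < ζ.re → G (ζ + P * Complex.I) = G ζ) :
    ∃ p : Polynomial ℂ, ∀ z, f z = p.eval z := by
  have hnorm : ∀ ζ : ℂ, a < ζ.re → ‖f (G ζ)‖ = Real.exp ζ.re := fun ζ hζ => by
    rw [(hG ζ hζ).1, Complex.norm_exp]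
  have hGc : ContinuousOn G {ζ : ℂ | a < ζ.re} := fun ζ hζ =>
    (hG ζ hζ).2.continuousAt.continuousWithinAt
  have hrect : ∀ T₁ T₂ : ℝ, a < T₁ → IsCompact (G '' (Icc T₁ T₂ ×ℂ Icc 0 P)) := by
    intro T₁ T₂ hT
    refine (isCompact_Icc.reProdIm isCompact_Icc).image_of_continuousOn (hGc.mono ?_)
    intro ζ hζ
    exact hT.trans_le (Complex.mem_reProdIm.1 hζ).1.1
  have hred : ∀ ζ : ℂ, a < ζ.re → ∃ ξ : ℂ, ξ.re = ζ.re ∧ ξ.im ∈ Icc 0 P ∧ G ξ = G ζ := by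
    intro ζ hζ
    have hp : Function.Periodic (fun t : ℝ => G (ζ.re + t * Complex.I)) P := by
      intro t
      have := hper (ζ.re + t * Complex.I) (by simpa using hζ)
      simp only
      rw [← this]
      congr 1
      push_cast; ring
    obtain ⟨y, hy, hyG⟩ := hp.exists_mem_Ico₀ hP ζ.im
    refine ⟨ζ.re + y * Complex.I, by simp, by simpa using ⟨hy.1, hy.2.le⟩, ?_⟩
    simp only [Complex.re_add_im] at hyG
    exact hyG.symm
  set T₀ := a + 1 with hT₀
  have haT : a < T₀ := by linarith
  have hclosed : IsClosed (G '' {ζ : ℂ | T₀ ≤ ζ.re}) := by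
    refine isClosed_of_closure_subset fun z hz => ?_
    set B := ‖f z‖ + 1 with hB
    have hBp : 0 < B := by positivity
    have hopen : IsOpen {x | ‖f x‖ < B} := isOpen_lt hf.continuous.norm continuous_const
    have h1 := hopen.inter_closure ⟨by simp [hB], hz⟩
    have h2 : {x | ‖f x‖ < B} ∩ G '' {ζ : ℂ | T₀ ≤ ζ.re} ⊆
        G '' (Icc T₀ (Real.log B) ×ℂ Icc 0 P) := by
      rintro _ ⟨hx, ζ, hζ, rfl⟩
      have haζ : a < ζ.re := haT.trans_le hζ
      obtain ⟨ξ, hξ1, hξ2, hξ3⟩ := hred ζ haζ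
      refine ⟨ξ, Complex.mem_reProdIm.2 ⟨⟨by rw [hξ1]; exact hζ, ?_⟩, hξ2⟩, hξ3⟩
      rw [mem_ofPred_eq, hnorm ζ haζ] at hx
      rw [hξ1, Real.le_log_iff_exp_le hBp]
      exact hx.le
    obtain ⟨ξ, hξ, rfl⟩ := closure_minimal h2 (hrect _ _ haT).isClosed h1
    exact ⟨ξ, (Complex.mem_reProdIm.1 hξ).1.1, rfl⟩
  have hopen : IsOpen (G '' {ζ : ℂ | T₀ < ζ.re}) := by
    refine isOpen_iff_mem_nhds.2 ?_
    rintro _ ⟨ζ, hζ, rfl⟩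
    have haζ : a < ζ.re := haT.trans hζ
    have hU : {ζ : ℂ | a < ζ.re} ∈ 𝓝 ζ :=
      (isOpen_lt continuous_const Complex.continuous_re).mem_nhds haζ
    have hU' : {ζ : ℂ | T₀ < ζ.re} ∈ 𝓝 ζ :=
      (isOpen_lt continuous_const Complex.continuous_re).mem_nhds hζ
    have han : AnalyticAt ℂ G ζ := DifferentiableOn.analyticAt
      (fun ξ hξ => (hG ξ hξ).2.differentiableAt.differentiableWithinAt) hU
    have hne : deriv G ζ ≠ 0 := by
      rw [(hG ζ haζ).2.deriv, (hG ζ haζ).1]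
      exact div_ne_zero (Complex.exp_ne_zero _) (hd ζ haζ)
    rw [← han.hasStrictDerivAt.map_nhds_eq hne]
    exact image_mem_map hU'
  obtain ⟨r, hr0, hr⟩ := (hrect T₀ T₀ haT).isBounded.subset_ball_lt 0 0
  have hcover : {z : ℂ | r < ‖z‖} ⊆ G '' {ζ : ℂ | T₀ < ζ.re} ∪ (G '' {ζ : ℂ | T₀ ≤ ζ.re})ᶜ := by
    intro z hz
    by_cases hzG : z ∈ G '' {ζ : ℂ | T₀ ≤ ζ.re}
    · left
      obtain ⟨ζ, hζ, rfl⟩ := hzG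
      rcases (show T₀ ≤ ζ.re from hζ).lt_or_eq with h | h
      · exact ⟨ζ, h, rfl⟩
      · exfalso
        obtain ⟨ξ, hξ1, hξ2, hξ3⟩ := hred ζ (haT.trans_le hζ)
        have : G ζ ∈ ball (0 : ℂ) r :=
          hr ⟨ξ, Complex.mem_reProdIm.2 ⟨by rw [hξ1, ← h]; simp, hξ2⟩, hξ3⟩
        rw [mem_ball_zero_iff] at this
        exact absurd hz (not_lt.2 this.le)
    · exact Or.inr hzG
  have hdisj : Disjoint (G '' {ζ : ℂ | T₀ < ζ.re}) (G '' {ζ : ℂ | T₀ ≤ ζ.re})ᶜ := by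
    refine disjoint_compl_right_iff_subset.2 (image_mono fun ζ hζ => ?_)
    exact le_of_lt (show T₀ < ζ.re from hζ)
  have hne : ({z : ℂ | r < ‖z‖} ∩ G '' {ζ : ℂ | T₀ < ζ.re}).Nonempty := by
    obtain ⟨M, hM⟩ := (isCompact_closedBall (0 : ℂ) r).exists_bound_of_continuousOn
      hf.continuous.continuousOn
    set s := max (T₀ + 1) (M + 1) with hs
    have hs1 : T₀ < s := lt_of_lt_of_le (by linarith) (le_max_left _ _)
    refine ⟨G s, ?_, s, by simpa using hs1, rfl⟩
    by_contra hcon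
    have h1 := hM (G s) (by simpa using hcon)
    rw [hnorm s (by simpa using haT.trans hs1), Complex.ofReal_re] at h1
    have := Real.add_one_le_exp s
    linarith [le_max_right (T₀ + 1) (M + 1)]
  have hsub := IsPreconnected.subset_left_of_subset_union hopen hclosed.isOpen_compl hdisj hcover
    hne (isPreconnected_setOf_lt_norm hr0)
  refine exists_polynomial_of_le_norm hf (Real.exp_pos T₀) (ρ := r + 1) fun z hz => ?_
  obtain ⟨ζ, hζ, rfl⟩ := hsub (show r < ‖z‖ by linarith)
  rw [hnorm ζ (haT.trans hζ)]
  exact Real.exp_le_exp.2 (le_of_lt hζ)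

/-- For a transcendental entire function with bounded singular values, the minimum modulus is
bounded on all large circles. -/
theorem TranscendentalEntire.exists_norm_le_on_circles (hf : TranscendentalEntire f)
    (hs : SingularValuesLE f R₀) (hR : 0 < R₀) (h0 : ‖f 0‖ ≤ R₀) :
    ∃ R₁ r₀ : ℝ, 0 < r₀ ∧ ∀ r, r₀ ≤ r → ∃ z, ‖z‖ = r ∧ ‖f z‖ ≤ R₁ := by
  obtain ⟨z₀, hz₀⟩ := hf.exists_lt_norm R₀
  have hfz₀ : f z₀ ≠ 0 := norm_pos_iff.1 (hR.trans hz₀)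
  set ζ₀ := Complex.log (f z₀) with hζ₀
  have hexp : f z₀ = Complex.exp ζ₀ := (Complex.exp_log hfz₀).symm
  have hre : Real.log R₀ < ζ₀.re := by rw [log_lt_re_iff_exp hR, ← hexp]; exact hz₀
  obtain ⟨G, hGζ₀, hG⟩ := exists_inverse_branch hf.1 hs hR hexp hre
  have hd : ∀ ζ : ℂ, Real.log R₀ < ζ.re → deriv f (G ζ) ≠ 0 := fun ζ hζ =>
    hs.deriv_ne_zero (by rw [(hG ζ hζ).1]; exact (log_lt_re_iff_exp hR).1 hζ)
  have hGc : ContinuousOn G {ζ : ℂ | Real.log R₀ < ζ.re} := fun ζ hζ =>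
    (hG ζ hζ).2.continuousAt.continuousWithinAt
  set p : ℕ → ℂ := fun k => ζ₀ + ((2 * Real.pi * k : ℝ) : ℂ) * Complex.I with hp
  have hpre : ∀ k, Real.log R₀ < (p k).re := fun k => by simpa [hp] using hre
  have hpf : ∀ k, f (G (p k)) = f z₀ := fun k => by
    rw [(hG _ (hpre k)).1, hexp]
    refine Complex.exp_eq_exp_iff_exists_int.2 ⟨k, ?_⟩
    simp only [hp]; push_cast; ring
  by_cases hinj : Function.Injective fun k => G (p k)
  · refine ⟨‖f z₀‖, max ‖z₀‖ 1, by positivity, fun r hr => ?_⟩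
    have hr0 : 0 < r := lt_of_lt_of_le one_pos ((le_max_right _ _).trans hr)
    obtain ⟨k, hk⟩ : ∃ k, r < ‖G (p k)‖ := by
      by_contra! hcon
      obtain ⟨M, hM⟩ := (isCompact_sphere (0 : ℂ) (3 * r)).exists_bound_of_continuousOn
        hf.1.continuous.continuousOn
      have hne : 0 < ‖f 0 - f z₀‖ := by
        refine norm_pos_iff.2 (sub_ne_zero.2 fun h => ?_)
        rw [h] at h0
        exact absurd hz₀ (not_lt.2 h0)
      have hbd : ∀ n : ℕ, (2 : ℝ) ^ n * ‖f 0 - f z₀‖ ≤ M + ‖f z₀‖ := by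
        intro n
        have := two_pow_card_mul_norm_sub_le hf.1 hr0 (fun z hz => hM z (by simpa using hz))
          (w := f z₀) ((Finset.range n).image fun k => G (p k)) (fun z hz => by
            obtain ⟨k, -, rfl⟩ := Finset.mem_image.1 hz
            exact ⟨hcon k, hpf k⟩)
        rwa [Finset.card_image_of_injective _ hinj, Finset.card_range] at this
      have ht : Tendsto (fun n : ℕ => (2 : ℝ) ^ n * ‖f 0 - f z₀‖) atTop atTop :=
        Filter.Tendsto.atTop_mul_const hne
          (_root_.tendsto_pow_atTop_atTop_of_one_lt (r := (2 : ℝ)) one_lt_two)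
      obtain ⟨n, hn⟩ := (ht.eventually_gt_atTop (M + ‖f z₀‖)).exists
      exact absurd (hbd n) (not_le.2 hn)
    have hcont : ContinuousOn (fun t : ℝ => ‖G (ζ₀ + t * Complex.I)‖)
        (Icc 0 (2 * Real.pi * k)) := by
      refine (hGc.comp (by fun_prop) fun t _ => ?_).norm
      simpa using hre
    have hmem : r ∈ Icc ‖G (ζ₀ + ((0 : ℝ) : ℂ) * Complex.I)‖
        ‖G (ζ₀ + ((2 * Real.pi * k : ℝ) : ℂ) * Complex.I)‖ := by
      refine ⟨?_, hk.le⟩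
      simpa [hGζ₀] using (le_max_left _ _).trans hr
    obtain ⟨t, -, ht⟩ := intermediate_value_Icc (by positivity) hcont hmem
    refine ⟨_, ht, le_of_eq ?_⟩
    rw [(hG _ (by simpa using hre)).1, hexp, Complex.norm_exp, Complex.norm_exp]
    simp
  · exfalso
    obtain ⟨k, l, hkl, hne⟩ : ∃ k l : ℕ, G (p k) = G (p l) ∧ k < l := by
      simp only [Function.Injective, not_forall] at hinj
      obtain ⟨k, l, h, hne⟩ := hinj
      rcases lt_or_gt_of_ne hne with h' | h'
      · exact ⟨k, l, h, h'⟩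
      · exact ⟨l, k, h.symm, h'⟩
    set P : ℝ := 2 * Real.pi * (l - k) with hP
    have hP0 : 0 < P := by
      have : (k : ℝ) < l := by exact_mod_cast hne
      have := sub_pos.2 this
      positivity
    have hopen : IsOpen {ζ : ℂ | Real.log R₀ < ζ.re} :=
      isOpen_lt continuous_const Complex.continuous_re
    have han : AnalyticOnNhd ℂ G {ζ : ℂ | Real.log R₀ < ζ.re} :=
      DifferentiableOn.analyticOnNhd
        (fun ξ hξ => (hG ξ hξ).2.differentiableAt.differentiableWithinAt) hopen
    have hshift : ∀ ζ : ℂ, Real.log R₀ < ζ.re → Real.log R₀ < (ζ + P * Complex.I).re :=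
      fun ζ hζ => by simpa using hζ
    have han' : AnalyticOnNhd ℂ (fun ζ => G (ζ + P * Complex.I)) {ζ : ℂ | Real.log R₀ < ζ.re} := by
      refine han.comp (g := G) (f := fun ζ : ℂ => ζ + P * Complex.I) ?_ fun ζ hζ => hshift ζ hζ
      exact fun ζ _ => analyticAt_id.add analyticAt_const
    have hpl : p l = p k + P * Complex.I := by
      simp only [hp, hP]; push_cast; ring
    have heq : (fun ζ => G (ζ + P * Complex.I)) =ᶠ[𝓝 (p k)] G := by
      have hst := (hf.1.analyticAt (G (p k))).hasStrictDerivAt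
      have hinv := hst.eventually_left_inverse (hd _ (hpre k))
      have h1 : ∀ᶠ ζ in 𝓝 (p k), hst.localInverse f _ _ (hd _ (hpre k)) (f (G ζ)) = G ζ :=
        ((han _ (hpre k)).continuousAt).eventually hinv
      have h2 : ∀ᶠ ζ in 𝓝 (p k), hst.localInverse f _ _ (hd _ (hpre k))
          (f (G (ζ + P * Complex.I))) = G (ζ + P * Complex.I) := by
        have hc : Tendsto (fun ζ => G (ζ + P * Complex.I)) (𝓝 (p k)) (𝓝 (G (p k))) := by
          have := (han' _ (hpre k)).continuousAt
          rw [ContinuousAt, ← hpl, ← hkl] at this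
          exact this
        exact hc.eventually hinv
      filter_upwards [h1, h2, hopen.mem_nhds (hpre k)] with ζ h1 h2 hζ
      rw [← h1, ← h2, (hG _ (hshift ζ hζ)).1, (hG ζ hζ).1]
      congr 1
      refine Complex.exp_eq_exp_iff_exists_int.2 ⟨l - k, ?_⟩
      simp only [hP]; push_cast; ring
    exact hf.2 (exists_polynomial_of_periodic_branch hf.1 hG hd hP0
      (han'.eqOn_of_preconnected_of_eventuallyEq han
        (convex_halfSpace_re_gt _).isPreconnected (hpre k) heq))

end CircleMinima

section Bloch

lemma ball_subset_image_of_norm_deriv_le {g : ℂ → ℂ} {p : ℂ} {t : ℝ} (ht : 0 < t)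
    (hg : DifferentiableOn ℂ g (ball p t))
    (hd : ∀ z ∈ ball p t, ‖deriv g z‖ ≤ 2 * ‖deriv g p‖) (hp : deriv g p ≠ 0) :
    ball (g p) (‖deriv g p‖ * t / 24) ⊆ g '' ball p t := by
  set m := ‖deriv g p‖ with hm
  have hm0 : 0 < m := norm_pos_iff.2 hp
  have hg' : DifferentiableOn ℂ (deriv g) (ball p t) := hg.deriv isOpen_ball
  have hmaps : MapsTo (deriv g) (ball p t) (closedBall (deriv g p) (3 * m)) := by
    intro z hz
    rw [mem_closedBall_iff_norm]
    linarith [norm_sub_le (deriv g z) (deriv g p), hd z hz]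
  have hsub : closedBall p (t / 6) ⊆ ball p t := closedBall_subset_ball (by linarith)
  have hdiff : ∀ z ∈ ball p t, DifferentiableAt ℂ g z := fun z hz =>
    hg.differentiableAt (isOpen_ball.mem_nhds hz)
  have hk : ∀ z ∈ closedBall p (t / 6),
      ‖(g z - deriv g p * z) - (g p - deriv g p * p)‖ ≤ m / 2 * ‖z - p‖ := by
    intro z hz
    refine Convex.norm_image_sub_le_of_norm_hasDerivWithin_le
      (f := fun z => g z - deriv g p * z) (f' := fun z => deriv g z - deriv g p)
      (s := closedBall p (t / 6)) (fun x hx => ?_) (fun x hx => ?_) (convex_closedBall _ _)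
      (mem_closedBall_self (by positivity)) hz
    · have := ((hdiff x (hsub hx)).hasDerivAt.fun_sub
        ((hasDerivAt_id x).const_mul (deriv g p))).hasDerivWithinAt (s := closedBall p (t / 6))
      simpa using this
    · have h1 := Complex.dist_le_div_mul_dist_of_mapsTo_ball hg' hmaps (hsub hx)
      rw [dist_eq_norm] at h1
      refine h1.trans ?_
      calc 3 * m / t * dist x p ≤ 3 * m / t * (t / 6) := by gcongr; exact hx
        _ = m / 2 := by field_simp; norm_num
  have hsph : ∀ z ∈ sphere p (t / 6), m * t / 12 ≤ ‖g z - g p‖ := by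
    intro z hz
    have h1 := hk z (sphere_subset_closedBall hz)
    have h2 : ‖z - p‖ = t / 6 := by rwa [mem_sphere_iff_norm] at hz
    have h3 : ‖deriv g p * (z - p)‖ ≤ ‖g z - g p‖ +
        ‖(g z - deriv g p * z) - (g p - deriv g p * p)‖ := by
      refine le_trans (le_of_eq ?_) (norm_sub_le _ _)
      congr 1; ring
    rw [norm_mul, h2, ← hm] at h3
    rw [h2] at h1
    linarith
  have hcl : DiffContOnCl ℂ g (ball p (t / 6)) := by
    refine DifferentiableOn.diffContOnCl ?_
    rw [closure_ball _ (by positivity)]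
    exact hg.mono hsub
  have hfreq : ∃ᶠ z in 𝓝 p, g z ≠ g p :=
    (((hdiff p (mem_ball_self ht)).hasDerivAt.eventually_ne hp).frequently).filter_mono
      nhdsWithin_le_nhds
  have := hcl.ball_subset_image_closedBall (by positivity) hsph hfreq
  rw [show m * t / 24 = m * t / 12 / 2 by ring]
  exact this.trans (image_mono hsub)

/-- A weak form of Bloch's theorem. -/
theorem exists_ball_subset_image {g : ℂ → ℂ} {a : ℂ} {δ : ℝ}
    (hg : DifferentiableOn ℂ g (ball a δ)) :
    ∃ w, ball w (‖deriv g a‖ * δ / 96) ⊆ g '' ball a δ := by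
  rcases le_or_gt δ 0 with hδ | hδ
  · refine ⟨0, ?_⟩
    rw [ball_eq_empty.2 (by nlinarith [norm_nonneg (deriv g a)])]
    exact empty_subset _
  by_cases ha : deriv g a = 0
  · exact ⟨0, by simp [ha]⟩
  have hsub : closedBall a (δ / 2) ⊆ ball a δ := closedBall_subset_ball (by linarith)
  have hg' : ContinuousOn (deriv g) (ball a δ) := (hg.deriv isOpen_ball).continuousOn
  have hφ : ContinuousOn (fun z => ‖deriv g z‖ * (δ / 2 - ‖z - a‖)) (closedBall a (δ / 2)) :=
    (hg'.mono hsub).norm.mul (by fun_prop)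
  obtain ⟨p, hp, hmax⟩ := (isCompact_closedBall a (δ / 2)).exists_isMaxOn
    ⟨a, mem_closedBall_self (by positivity)⟩ hφ
  have ha0 : 0 < ‖deriv g a‖ := norm_pos_iff.2 ha
  have h1 : ‖deriv g a‖ * (δ / 2) ≤ ‖deriv g p‖ * (δ / 2 - ‖p - a‖) := by
    have := hmax (mem_closedBall_self (by positivity : 0 ≤ δ / 2))
    simpa using this
  have hpos : 0 < ‖deriv g p‖ * (δ / 2 - ‖p - a‖) := lt_of_lt_of_le (by positivity) h1
  have hp0 : 0 < ‖deriv g p‖ := by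
    refine lt_of_le_of_ne (norm_nonneg _) fun h => ?_
    rw [← h, zero_mul] at hpos
    exact hpos.false
  have ht : 0 < (δ / 2 - ‖p - a‖) / 2 := half_pos ((pos_iff_pos_of_mul_pos hpos).1 hp0)
  set t := (δ / 2 - ‖p - a‖) / 2 with htdef
  have hball : ball p t ⊆ ball a δ := by
    refine ball_subset_ball' ?_
    rw [dist_eq_norm]; linarith [norm_nonneg (p - a)]
  refine ⟨g p, Subset.trans ?_ ((ball_subset_image_of_norm_deriv_le ht (hg.mono hball) ?_
    (norm_pos_iff.1 hp0)).trans (image_mono hball))⟩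
  · refine ball_subset_ball ?_
    have : ‖deriv g p‖ * t = ‖deriv g p‖ * (δ / 2 - ‖p - a‖) / 2 := by rw [htdef]; ring
    linarith
  · intro z hz
    have hz1 : ‖z - p‖ < t := by rwa [mem_ball_iff_norm] at hz
    have hz2 : ‖z - a‖ ≤ ‖z - p‖ + ‖p - a‖ := norm_sub_le_norm_sub_add_norm_sub z p a
    have hz3 : t ≤ δ / 2 - ‖z - a‖ := by linarith
    have hz4 : z ∈ closedBall a (δ / 2) := by
      rw [mem_closedBall_iff_norm]; linarith
    have h2 : ‖deriv g z‖ * (δ / 2 - ‖z - a‖) ≤ ‖deriv g p‖ * (δ / 2 - ‖p - a‖) := hmax hz4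
    have h3 : ‖deriv g z‖ * t ≤ ‖deriv g p‖ * (2 * t) := by
      refine (mul_le_mul_of_nonneg_left hz3 (norm_nonneg _)).trans (h2.trans (le_of_eq ?_))
      rw [htdef]; ring
    exact le_of_mul_le_mul_right (by linarith) ht

lemma exists_log_on_ball {h : ℂ → ℂ} {a : ℂ} {δ : ℝ} (hh : DifferentiableOn ℂ h (ball a δ))
    (hne : ∀ z ∈ ball a δ, h z ≠ 0) :
    ∃ L : ℂ → ℂ, ∀ z ∈ ball a δ, Complex.exp (L z) = h z ∧
      HasDerivAt L (deriv h z / h z) z := by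
  rcases le_or_gt δ 0 with hδ | hδ
  · exact ⟨0, by simp [ball_eq_empty.2 hδ]⟩
  obtain ⟨L, hL⟩ := DifferentiableOn.isExactOn_ball ((hh.deriv isOpen_ball).fun_div hh hne)
  have hder : ∀ z ∈ ball a δ, HasDerivAt (fun z => h z * Complex.exp (-L z)) 0 z := by
    intro z hz
    have := (hh.differentiableAt (isOpen_ball.mem_nhds hz)).hasDerivAt.mul (hL z hz).neg.cexp
    refine this.congr_deriv ?_
    have := hne z hz
    field_simp
    ring
  set c := h a * Complex.exp (-L a) with hc
  have hcne : c ≠ 0 := mul_ne_zero (hne a (mem_ball_self hδ)) (Complex.exp_ne_zero _)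
  refine ⟨fun z => L z + Complex.log c, fun z hz => ⟨?_, (hL z hz).add_const _⟩⟩
  have := isOpen_ball.is_const_of_deriv_eq_zero (convex_ball a δ).isPreconnected
    (fun z hz => (hder z hz).differentiableAt.differentiableWithinAt)
    (fun z hz => (hder z hz).deriv) hz (mem_ball_self hδ)
  rw [Complex.exp_add, Complex.exp_log hcne, hc, ← this, Complex.exp_neg]
  field_simp

/-- If `f` is small somewhere on every large circle, then holomorphic functions into the set
where `f` is large have a controlled logarithmic derivative. -/
theorem norm_deriv_mul_le_of_circles {f : ℂ → ℂ} {R₁ r₀ : ℝ} (hr₀ : 0 < r₀)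
    (hcirc : ∀ r, r₀ ≤ r → ∃ z, ‖z‖ = r ∧ ‖f z‖ ≤ R₁) {h : ℂ → ℂ} {a : ℂ} {δ : ℝ} (hδ : 0 < δ)
    (hh : DifferentiableOn ℂ h (ball a δ)) (hbig : ∀ z ∈ ball a δ, r₀ < ‖h z‖ ∧ R₁ < ‖f (h z)‖) :
    ‖deriv h a‖ * δ ≤ 384 * ‖h a‖ := by
  have hne : ∀ z ∈ ball a δ, h z ≠ 0 := fun z hz => norm_pos_iff.1 (hr₀.trans (hbig z hz).1)
  obtain ⟨L, hL⟩ := exists_log_on_ball hh hne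
  obtain ⟨w, hw⟩ := exists_ball_subset_image (g := L) (a := a) (δ := δ)
    fun z hz => (hL z hz).2.differentiableAt.differentiableWithinAt
  by_contra! hcon
  have ha := mem_ball_self hδ (x := a)
  have hpos : 0 < ‖h a‖ := norm_pos_iff.2 (hne a ha)
  have h4 : 4 < ‖deriv L a‖ * δ / 96 := by
    rw [(hL a ha).2.deriv, norm_div, lt_div_iff₀ (by norm_num), div_mul_eq_mul_div,
      lt_div_iff₀ hpos]
    linarith
  obtain ⟨z₁, hz₁, hLz₁⟩ := hw (mem_ball_self (by linarith))
  have hr : r₀ ≤ ‖Complex.exp w‖ := by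
    rw [← hLz₁, (hL z₁ hz₁).1]; exact (hbig z₁ hz₁).1.le
  obtain ⟨u, hu, hfu⟩ := hcirc _ hr
  set θ := (u / Complex.exp w).arg with hθ
  have hnorm : ‖u / Complex.exp w‖ = 1 := by
    rw [norm_div, hu, div_self (norm_ne_zero_iff.2 (Complex.exp_ne_zero _))]
  have hexp : Complex.exp (w + θ * Complex.I) = u := by
    have h1 := Complex.norm_mul_exp_arg_mul_I (u / Complex.exp w)
    rw [hnorm, Complex.ofReal_one, one_mul] at h1
    rw [Complex.exp_add, h1, mul_div_cancel₀ _ (Complex.exp_ne_zero w)]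
  have hmem : w + θ * Complex.I ∈ ball w (‖deriv L a‖ * δ / 96) := by
    rw [mem_ball_iff_norm, add_sub_cancel_left, norm_mul, Complex.norm_I, mul_one,
      Complex.norm_real, Real.norm_eq_abs]
    have := Complex.abs_arg_le_pi (u / Complex.exp w)
    linarith [Real.pi_lt_four]
  obtain ⟨z₂, hz₂, hLz₂⟩ := hw hmem
  have h5 : h z₂ = u := by rw [← (hL z₂ hz₂).1, hLz₂, hexp]
  have h6 := (hbig z₂ hz₂).2
  rw [h5] at h6
  exact absurd hfu (not_le.2 h6)

end Bloch

section EscapingPoints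

/-- Quantitative expansion of `f` outside a disc in the logarithmic metric. -/
structure IsExpansionRadius (f : ℂ → ℂ) (R : ℝ) : Prop where
  one_le : 1 ≤ R
  circles : ∀ r, R ≤ r → ∃ z, ‖z‖ = r ∧ ‖f z‖ ≤ R
  expansion : ∀ z, R < ‖f z‖ →
    (Real.log ‖f z‖ - Real.log R) * ‖f z‖ ≤ 384 * (‖z‖ * ‖deriv f z‖)

lemma ELClass.exists_isExpansionRadius {f : ℂ → ℂ} (hf : ELClass f) :
    ∃ R, IsExpansionRadius f R := by
  obtain ⟨C, hC⟩ := hf.2.exists_norm_le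
  set R₀ : ℝ := max (max C ‖f 0‖) 1 with hR₀
  have hR₀1 : 1 ≤ R₀ := le_max_right _ _
  have hR₀0 : 0 < R₀ := by linarith
  have hs : SingularValuesLE f R₀ := fun w hw =>
    (hC w hw).trans ((le_max_left _ _).trans (le_max_left _ _))
  obtain ⟨R₁, r₀, hr₀, hcirc⟩ := hf.1.exists_norm_le_on_circles hs hR₀0
    ((le_max_right _ _).trans (le_max_left _ _))
  obtain ⟨M, hM⟩ := (isCompact_closedBall (0 : ℂ) r₀).exists_bound_of_continuousOn
    hf.1.1.continuous.continuousOn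
  set R := max (max R₀ R₁) (max r₀ M) with hR
  have h1 : R₀ ≤ R := (le_max_left _ _).trans (le_max_left _ _)
  have h2 : R₁ ≤ R := (le_max_right _ _).trans (le_max_left _ _)
  have h3 : r₀ ≤ R := (le_max_left _ _).trans (le_max_right _ _)
  have h4 : M ≤ R := (le_max_right _ _).trans (le_max_right _ _)
  have hR0 : 0 < R := by linarith
  refine ⟨R, by linarith, fun r hr => ?_, fun z hz => ?_⟩
  · obtain ⟨z, hz1, hz2⟩ := hcirc r (h3.trans hr)
    exact ⟨z, hz1, hz2.trans h2⟩
  have hfz : f z ≠ 0 := norm_pos_iff.1 (hR0.trans hz)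
  set ζ₀ := Complex.log (f z) with hζ₀
  have hexp : f z = Complex.exp ζ₀ := (Complex.exp_log hfz).symm
  have hre : Real.log R < ζ₀.re := by rw [log_lt_re_iff_exp hR0, ← hexp]; exact hz
  have hlog : Real.log R₀ ≤ Real.log R := Real.log_le_log hR₀0 h1
  obtain ⟨G, hGζ₀, hG⟩ := exists_inverse_branch hf.1.1 hs hR₀0 hexp (hlog.trans_lt hre)
  have hball : ∀ ζ ∈ ball ζ₀ (ζ₀.re - Real.log R), Real.log R < ζ.re := by
    intro ζ hζ
    rw [mem_ball_iff_norm'] at hζ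
    have := (Complex.re_le_norm (ζ₀ - ζ)).trans_lt hζ
    rw [Complex.sub_re] at this
    linarith
  have hK := norm_deriv_mul_le_of_circles (f := f) (R₁ := R₁) hr₀ hcirc (h := G) (a := ζ₀)
    (sub_pos.2 hre)
    (fun ζ hζ => (hG ζ (hlog.trans_lt (hball ζ hζ))).2.differentiableAt.differentiableWithinAt)
    (fun ζ hζ => by
      have h5 : R < ‖f (G ζ)‖ := by
        rw [(hG ζ (hlog.trans_lt (hball ζ hζ))).1]
        exact (log_lt_re_iff_exp hR0).1 (hball ζ hζ)
      refine ⟨?_, h2.trans_lt h5⟩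
      by_contra hcon
      exact absurd (hM (G ζ) (by simpa using hcon)) (not_le.2 (h4.trans_lt h5)))
  have hd : 0 < ‖deriv f z‖ := norm_pos_iff.2 (hs.deriv_ne_zero (h1.trans_lt hz))
  rw [(hG ζ₀ (hlog.trans_lt hre)).2.deriv, hGζ₀, norm_div, hζ₀, Complex.log_re,
    div_mul_eq_mul_div, div_le_iff₀ hd] at hK
  linarith

lemma chordalDist_comm (p q : Option ℂ) : chordalDist p q = chordalDist q p := by
  match p, q with
  | none, none => rfl
  | none, some _ => rfl
  | some _, none => rfl
  | some z, some w =>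
    change 2 * ‖z - w‖ / _ = 2 * ‖w - z‖ / _
    rw [norm_sub_rev, mul_comm (Real.sqrt _)]

lemma chordalDist_none_le (x : ℂ) (q : Option ℂ) :
    chordalDist (some x) none ≤ chordalDist (some x) q + chordalDist q none := by
  cases q with
  | none => simp [chordalDist]
  | some u =>
    have hx : 0 < Real.sqrt (1 + ‖x‖ ^ 2) := Real.sqrt_pos.2 (by positivity)
    have hu : 0 < Real.sqrt (1 + ‖u‖ ^ 2) := Real.sqrt_pos.2 (by positivity)
    have hkey : Real.sqrt (1 + ‖u‖ ^ 2) ≤ ‖x - u‖ + Real.sqrt (1 + ‖x‖ ^ 2) := by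
      rw [Real.sqrt_le_left (by positivity)]
      have h1 : ‖x‖ ≤ Real.sqrt (1 + ‖x‖ ^ 2) := Real.le_sqrt_of_sq_le (by linarith)
      have h2 : Real.sqrt (1 + ‖x‖ ^ 2) ^ 2 = 1 + ‖x‖ ^ 2 := Real.sq_sqrt (by positivity)
      have h3 : ‖u‖ ≤ ‖x - u‖ + ‖x‖ := by
        rw [norm_sub_rev]; exact (norm_sub_norm_le u x |> sub_le_iff_le_add.1)
      have h4 := mul_le_mul_of_nonneg_left h1 (norm_nonneg (x - u))
      nlinarith [norm_nonneg u, norm_nonneg x, norm_nonneg (x - u)]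
    simp only [chordalDist]
    rw [div_add_div _ _ (by positivity) hu.ne', div_le_div_iff₀ hx (by positivity)]
    have := mul_le_mul_of_nonneg_left hkey
      (by positivity : 0 ≤ 2 * (Real.sqrt (1 + ‖x‖ ^ 2) * Real.sqrt (1 + ‖u‖ ^ 2)))
    linarith

/-- Iterates are uniformly large near an escaping point of the Fatou set. -/
lemma exists_ball_forall_lt_norm_iterate {f : ℂ → ℂ} (hf : Continuous f) {z : ℂ}
    (hz : z ∈ fatouSet f) (hesc : Tendsto (fun n => ‖f^[n] z‖) atTop atTop) (R : ℝ) :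
    ∃ δ > 0, ∃ n₀ : ℕ, ∀ n, n₀ ≤ n → ∀ w ∈ ball z δ, R < ‖f^[n] w‖ := by
  obtain ⟨U, hU, hnorm⟩ := hz
  obtain ⟨δ₀, hδ₀, hδU⟩ := Metric.nhds_basis_closedBall.mem_iff.1 hU
  by_contra! hcon
  have hfreq : ∀ j : ℕ, ∃ᶠ n in atTop, ∃ w ∈ ball z (δ₀ / (j + 1)), ‖f^[n] w‖ ≤ R := by
    intro j
    refine frequently_atTop.2 fun n₀ => ?_
    obtain ⟨n, hn, w, hw, h⟩ := hcon (δ₀ / (j + 1)) (by positivity) n₀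
    exact ⟨n, hn, w, hw, h⟩
  obtain ⟨φ, hφ, hφw⟩ := extraction_forall_of_frequently hfreq
  choose w hw hwR using hφw
  obtain ⟨ψ, hψ, g, hg⟩ := hnorm φ hφ
  have hwlim : Tendsto w atTop (𝓝 z) := by
    refine tendsto_iff_dist_tendsto_zero.2 (squeeze_zero (fun _ => dist_nonneg)
      (fun j => (hw j).le) ?_)
    exact tendsto_const_div_atTop_nhds_zero_nat δ₀ |>.comp (tendsto_add_atTop_nat 1) |>.congr
      fun j => by simp
  set d : ℝ → ℝ := fun r => 2 / Real.sqrt (1 + r ^ 2) with hd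
  have hdtend : Tendsto d atTop (𝓝 0) := by
    refine tendsto_const_nhds.div_atTop (tendsto_atTop_mono (fun r => ?_) tendsto_id)
    exact Real.le_sqrt_of_sq_le (by simp)
  set ε := d R / 3 with hε
  have hdR : 0 < d R := div_pos two_pos (Real.sqrt_pos.2 (by positivity))
  have hε0 : 0 < ε := by positivity
  have hu := hg (closedBall z δ₀) hδU (isCompact_closedBall z δ₀) ε hε0
  have hinf : ∀ᶠ m in atTop, d ‖f^[φ (ψ m)] z‖ < ε :=
    ((hdtend.comp hesc).comp (hφ.comp hψ).tendsto_atTop).eventually (gt_mem_nhds hε0)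
  obtain ⟨m, hm1, hm2⟩ := (hu.and hinf).exists
  have hcont : ContinuousAt (fun w => d ‖f^[φ (ψ m)] w‖) z := by
    have h1 : Continuous (fun w => ‖f^[φ (ψ m)] w‖) := (hf.iterate _).norm
    refine ((continuous_const.div (Real.continuous_sqrt.comp (by fun_prop))
      fun w => ?_)).continuousAt
    exact (Real.sqrt_pos.2 (by positivity)).ne'
  have hwψ : Tendsto (fun j => w (ψ j)) atTop (𝓝 z) := hwlim.comp hψ.tendsto_atTop
  have hA := hwψ.eventually (hcont.eventually (gt_mem_nhds hm2))
  have hB := hwψ.eventually (closedBall_mem_nhds z hδ₀)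
  obtain ⟨j, hj1, hj2, hj3⟩ := (hu.and (hA.and hB)).exists
  set x := f^[φ (ψ j)] (w (ψ j)) with hx
  set y := f^[φ (ψ m)] (w (ψ j)) with hy
  have e1 := hj1 _ hj3
  have e2 := hm1 _ hj3
  rw [chordalDist_comm] at e2
  have t1 := chordalDist_none_le x (g (w (ψ j)))
  have t2 : chordalDist (g (w (ψ j))) none ≤
      chordalDist (g (w (ψ j))) (some y) + chordalDist (some y) none := by
    cases h : g (w (ψ j)) with
    | none =>
      have : chordalDist none none = 0 := rfl
      have p1 : 0 ≤ chordalDist (some y) none := by simp only [chordalDist]; positivity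
      rw [this, chordalDist_comm]
      linarith
    | some u => exact chordalDist_none_le u _
  have e3 : chordalDist (some y) none < ε := hj2
  have e4 : d R ≤ chordalDist (some x) none := by
    have hxR : ‖x‖ ≤ R := hwR (ψ j)
    simp only [hd, chordalDist]
    gcongr
  linarith

lemma deriv_iterate_succ {f : ℂ → ℂ} (hf : Differentiable ℂ f) (n : ℕ) (z : ℂ) :
    deriv f^[n + 1] z = deriv f (f^[n] z) * deriv f^[n] z := by
  rw [Function.iterate_succ']
  exact deriv_comp z (hf _) (hf.iterate n z)

/-- Escaping points whose orbits stay in the region of expansion lie in the Julia set. -/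
theorem IsExpansionRadius.mem_juliaSet {f : ℂ → ℂ} {R : ℝ} (hR : IsExpansionRadius f R)
    (hf : Differentiable ℂ f) {z : ℂ} (hz0 : z ≠ 0) (hz : ∀ n, R < ‖f^[n + 1] z‖)
    (hesc : Tendsto (fun n => ‖f^[n] z‖) atTop atTop) : z ∈ juliaSet f := by
  intro hfat
  have hR0 : 0 < R := one_pos.trans_le hR.one_le
  obtain ⟨δ, hδ, n₀, hn₀⟩ := exists_ball_forall_lt_norm_iterate hf.continuous hfat hesc R
  have hpos : ∀ n, 0 < ‖f^[n] z‖ := by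
    rintro (_ | n)
    · exact norm_pos_iff.2 hz0
    · exact hR0.trans (hz n)
  set q : ℕ → ℝ := fun n => ‖deriv f^[n] z‖ / ‖f^[n] z‖ with hq
  have hbound : ∀ n, n₀ ≤ n → q n ≤ 384 / δ := by
    intro n hn
    have := norm_deriv_mul_le_of_circles hR0 hR.circles (h := f^[n]) (a := z) hδ
      (hf.iterate n).differentiableOn (fun w hw => ⟨hn₀ n hn w hw, by
        rw [← Function.iterate_succ_apply' f]
        exact hn₀ (n + 1) (by omega) w hw⟩)
    rw [hq]
    simp only
    rw [div_le_div_iff₀ (hpos n) hδ]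
    exact this
  have hstep : ∀ n, (Real.log ‖f^[n + 1] z‖ - Real.log R) / 384 * q n ≤ q (n + 1) := by
    intro n
    have h1 := hR.expansion (f^[n] z) (by rw [← Function.iterate_succ_apply' f]; exact hz n)
    rw [← Function.iterate_succ_apply' f] at h1
    simp only [hq]
    rw [deriv_iterate_succ hf, norm_mul, div_mul_div_comm,
      div_le_div_iff₀ (mul_pos (by norm_num) (hpos n)) (hpos (n + 1))]
    nlinarith [norm_nonneg (deriv f^[n] z)]
  have hqpos : ∀ n, 0 < q n := by
    intro n
    induction n with
    | zero =>
      have : 0 < ‖z‖ := norm_pos_iff.2 hz0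
      simp only [hq]
      have h1 : deriv f^[0] z = 1 := by simp
      rw [h1, Function.iterate_zero_apply, norm_one]
      positivity
    | succ n ih =>
      refine lt_of_lt_of_le (mul_pos (div_pos (sub_pos.2 ?_) (by norm_num)) ih) (hstep n)
      exact Real.log_lt_log hR0 (hz n)
  have hlarge : ∀ᶠ n in atTop, 2 ≤ (Real.log ‖f^[n + 1] z‖ - Real.log R) / 384 := by
    have h1 : Tendsto (fun n => Real.log ‖f^[n + 1] z‖) atTop atTop :=
      Real.tendsto_log_atTop.comp (hesc.comp (tendsto_add_atTop_nat 1))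
    filter_upwards [h1.eventually_ge_atTop (Real.log R + 768)] with n hn
    linarith
  obtain ⟨n₁, hn₁⟩ := eventually_atTop.1 hlarge
  have hgrow : ∀ k : ℕ, 2 ^ k * q n₁ ≤ q (n₁ + k) := by
    intro k
    induction k with
    | zero => simp
    | succ k ih =>
      have h1 := hstep (n₁ + k)
      have h2 := mul_le_mul_of_nonneg_right (hn₁ (n₁ + k) (by omega)) (hqpos (n₁ + k)).le
      rw [pow_succ, ← add_assoc]
      linarith
  have htend : Tendsto (fun k : ℕ => (2 : ℝ) ^ k * q n₁) atTop atTop :=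
    Filter.Tendsto.atTop_mul_const (hqpos n₁)
      (_root_.tendsto_pow_atTop_atTop_of_one_lt (r := (2 : ℝ)) one_lt_two)
  obtain ⟨k, hk1, hk2⟩ := ((htend.eventually_gt_atTop (384 / δ)).and
    (eventually_ge_atTop n₀)).exists
  linarith [hgrow k, hbound (n₁ + k) (by omega)]

end EscapingPoints

section ChangeOfVariables

lemma logArea_mono {A B : Set ℂ} (h : A ⊆ B) : logArea A ≤ logArea B :=
  lintegral_mono_set h

lemma logArea_iUnion_le (A : ℕ → Set ℂ) : logArea (⋃ i, A i) ≤ ∑' i, logArea (A i) :=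
  lintegral_iUnion_le _ _

lemma logArea_union_le (A B : Set ℂ) : logArea (A ∪ B) ≤ logArea A + logArea B :=
  lintegral_union_le _ _ _

lemma measurable_ofReal_norm_sq_inv :
    Measurable fun z : ℂ => ENNReal.ofReal ((‖z‖ ^ 2)⁻¹) := by fun_prop

lemma exists_seq_injOn_cover {f : ℂ → ℂ} (hf : Differentiable ℂ f) :
    ∃ u : ℕ → Set ℂ, (∀ i, MeasurableSet (u i)) ∧ (∀ i, InjOn f (u i)) ∧
      {z | deriv f z ≠ 0} ⊆ ⋃ i, u i := by
  have hB := TopologicalSpace.isBasis_countableBasis ℂ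
  set S : Set (Set ℂ) := insert ∅ {V ∈ TopologicalSpace.countableBasis ℂ | InjOn f V} with hS
  have hSc : S.Countable := by
    refine Countable.insert _ ((TopologicalSpace.countable_countableBasis ℂ).mono ?_)
    exact fun V hV => hV.1
  obtain ⟨u, hu⟩ := hSc.exists_eq_range ⟨∅, mem_insert _ _⟩
  have hmem : ∀ i, u i ∈ S := fun i => by rw [hu]; exact mem_range_self i
  refine ⟨u, fun i => ?_, fun i => ?_, fun z hz => ?_⟩
  · rcases hmem i with h | h
    · rw [h]; exact MeasurableSet.empty
    · exact (hB.isOpen h.1).measurableSet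
  · rcases hmem i with h | h
    · rw [h]; exact injOn_empty f
    · exact h.2
  · have hst := (hf.analyticAt z).hasStrictDerivAt
    have hinv := hst.eventually_left_inverse hz
    obtain ⟨V, hV, hzV, hVs⟩ := hB.mem_nhds_iff.1 hinv
    have hVS : V ∈ S := by
      refine Or.inr ⟨hV, fun a ha b hb hab => ?_⟩
      have h1 := hVs ha
      have h2 := hVs hb
      simp only [mem_ofPred_eq] at h1 h2
      rw [← h1, ← h2, hab]
    rw [hu] at hVS
    obtain ⟨i, rfl⟩ := hVS
    exact mem_iUnion.2 ⟨i, hzV⟩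

/-- Logarithmic area of preimages under a map that is expanding in the logarithmic metric and of
bounded multiplicity. -/
theorem logArea_inter_preimage_le {f : ℂ → ℂ} (hf : Differentiable ℂ f) {A E : Set ℂ}
    (hA : MeasurableSet A) (hE : MeasurableSet E) {N c : ℝ} (hc : 0 < c)
    (hexp : ∀ z ∈ A, c * ‖f z‖ ≤ ‖z‖ * ‖deriv f z‖) (hne : ∀ z ∈ A, f z ≠ 0)
    (hN : ∀ w, ∀ S : Finset ℂ, (∀ z ∈ S, z ∈ A ∧ f z = w) → (S.card : ℝ) ≤ N) :
    logArea (A ∩ f ⁻¹' E) ≤ ENNReal.ofReal (N / c ^ 2) * logArea E := by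
  obtain ⟨u, hum, huinj, hucov⟩ := exists_seq_injOn_cover hf
  set g : ℂ → ℝ≥0∞ := fun z => ENNReal.ofReal ((‖z‖ ^ 2)⁻¹) with hg
  have hgm : Measurable g := measurable_ofReal_norm_sq_inv
  set V : ℕ → Set ℂ := fun i => disjointed u i ∩ (A ∩ f ⁻¹' E) with hV
  have hAE : MeasurableSet (A ∩ f ⁻¹' E) := hA.inter (hf.continuous.measurable hE)
  have hVm : ∀ i, MeasurableSet (V i) := fun i => (MeasurableSet.disjointed hum i).inter hAE
  have hdisj : Pairwise (Function.onFun Disjoint V) := fun i j hij =>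
    (disjoint_disjointed u hij).mono inter_subset_left inter_subset_left
  have hpos : ∀ z ∈ A, 0 < ‖z‖ * ‖deriv f z‖ := fun z hz =>
    lt_of_lt_of_le (mul_pos hc (norm_pos_iff.2 (hne z hz))) (hexp z hz)
  have hunion : ⋃ i, V i = A ∩ f ⁻¹' E := by
    rw [← iUnion_inter, iUnion_disjointed]
    refine inter_eq_right.2 fun z hz => hucov ?_
    rintro h0
    have := hpos z hz.1
    rw [h0] at this
    simp at this
  have hVinj : ∀ i, InjOn f (V i) := fun i =>
    (huinj i).mono (inter_subset_left.trans (disjointed_subset u i))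
  have hder : ∀ i, ∀ z ∈ V i, HasFDerivWithinAt f ((deriv f z • (1 : ℂ →L[ℝ] ℂ)) : ℂ →L[ℝ] ℂ)
      (V i) z := fun i z _ => (hf z).hasDerivAt.complexToReal_fderiv.hasFDerivWithinAt
  have hdet : ∀ a : ℂ, ((a • (1 : ℂ →L[ℝ] ℂ)) : ℂ →L[ℝ] ℂ).det = ‖a‖ ^ 2 := by
    intro a
    rw [← Complex.normSq_eq_norm_sq, ← Algebra.norm_complex_apply, Algebra.norm_apply]
    rfl
  have hpiece : ∀ i, logArea (V i) ≤
      ENNReal.ofReal ((c ^ 2)⁻¹) * ∫⁻ w, (f '' V i).indicator g w := by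
    intro i
    rw [lintegral_indicator (measurable_image_of_fderivWithin (hVm i) (hder i) (hVinj i)),
      lintegral_image_eq_lintegral_abs_det_fderiv_mul volume (hVm i) (hder i) (hVinj i),
      ← lintegral_const_mul' _ _ ENNReal.ofReal_ne_top]
    refine setLIntegral_mono' (hVm i) fun z hz => ?_
    have hzA : z ∈ A := hz.2.1
    rw [hdet, ← ENNReal.ofReal_mul (abs_nonneg _), ← ENNReal.ofReal_mul (by positivity)]
    refine ENNReal.ofReal_le_ofReal ?_
    have h1 := hexp z hzA
    have h2 := hpos z hzA
    have h3 : 0 < ‖f z‖ := norm_pos_iff.2 (hne z hzA)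
    have h4 : 0 < ‖z‖ := (pos_iff_pos_of_mul_pos h2).2 (by
      refine (norm_nonneg _).lt_of_ne fun h => ?_
      rw [← h] at h2; simp at h2)
    rw [abs_of_nonneg (by positivity), ← mul_assoc, ← div_eq_mul_inv,
      ← div_eq_inv_mul, div_div, inv_eq_one_div, div_le_div_iff₀ (by positivity) (by positivity)]
    have := mul_self_le_mul_self (by positivity) h1
    nlinarith
  have hmult : ∀ w, ∑' i, (f '' V i).indicator g w ≤ ENNReal.ofReal N * E.indicator g w := by
    intro w
    refine ENNReal.tsum_le_of_sum_range_le fun n => ?_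
    classical
    set I := (Finset.range n).filter fun i => w ∈ f '' V i with hI
    by_cases hw : w ∈ E
    swap
    · rw [Finset.sum_eq_zero]
      · exact zero_le
      · intro i _
        refine indicator_of_notMem ?_ _
        rintro ⟨z, hz, rfl⟩
        exact hw hz.2.2
    have hsum : ∑ i ∈ Finset.range n, (f '' V i).indicator g w = I.card * g w := by
      simp only [indicator_apply]
      rw [← Finset.sum_filter, Finset.sum_const, nsmul_eq_mul]
    rw [hsum, indicator_of_mem hw]
    gcongr
    have hex : ∀ i ∈ I, ∃ z, z ∈ V i ∧ f z = w := fun i hi => (Finset.mem_filter.1 hi).2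
    choose! ζ hζ hζw using hex
    have hinj : Set.InjOn ζ I := by
      intro i hi j hj hij
      by_contra hne'
      exact disjoint_left.1 (hdisj hne') (hζ i hi) (hij ▸ hζ j hj)
    have h1 := hN w (I.image ζ) (fun z hz => by
      obtain ⟨i, hi, rfl⟩ := Finset.mem_image.1 hz
      exact ⟨(hζ i hi).2.1, hζw i hi⟩)
    rw [Finset.card_image_of_injOn hinj] at h1
    rw [← ENNReal.ofReal_natCast]
    exact ENNReal.ofReal_le_ofReal h1
  calc logArea (A ∩ f ⁻¹' E) = ∑' i, logArea (V i) := by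
        rw [← hunion]; exact lintegral_iUnion hVm hdisj _
    _ ≤ ∑' i, ENNReal.ofReal ((c ^ 2)⁻¹) * ∫⁻ w, (f '' V i).indicator g w :=
        ENNReal.tsum_le_tsum hpiece
    _ = ENNReal.ofReal ((c ^ 2)⁻¹) * ∫⁻ w, ∑' i, (f '' V i).indicator g w := by
        rw [ENNReal.tsum_mul_left, lintegral_tsum]
        exact fun i => (hgm.indicator
          (measurable_image_of_fderivWithin (hVm i) (hder i) (hVinj i))).aemeasurable
    _ ≤ ENNReal.ofReal ((c ^ 2)⁻¹) * ∫⁻ w, ENNReal.ofReal N * E.indicator g w := by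
        gcongr with w; exact hmult w
    _ = ENNReal.ofReal (N / c ^ 2) * logArea E := by
        rw [lintegral_const_mul' _ _ ENNReal.ofReal_ne_top, lintegral_indicator hE, ← mul_assoc,
          ← ENNReal.ofReal_mul (by positivity), div_eq_inv_mul]
        rfl

end ChangeOfVariables

section ContractionOfPreimages

lemma card_le_of_norm_le_exp_rpow {f : ℂ → ℂ} (hf : Differentiable ℂ f) {β s : ℝ} (hs : 1 ≤ s)
    (hβ : 0 < β) (hM : ∀ z, s ≤ ‖z‖ → ‖f z‖ ≤ Real.exp (‖z‖ ^ β)) {w : ℂ}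
    (hw : ‖f 0‖ + 1 ≤ ‖w‖) (S : Finset ℂ)
    (hS : ∀ z ∈ S, s ≤ ‖z‖ ∧ ‖z‖ < 2 * s ∧ f z = w) : (S.card : ℝ) ≤ 3 * (6 * s) ^ β := by
  rcases S.eq_empty_or_nonempty with rfl | ⟨z₀, hz₀⟩
  · simp only [Finset.card_empty, Nat.cast_zero]; positivity
  have h6 : 1 ≤ (6 * s) ^ β := Real.one_le_rpow (by linarith) hβ.le
  have hw' : ‖w‖ ≤ Real.exp ((6 * s) ^ β) := by
    obtain ⟨h1, h2, rfl⟩ := hS z₀ hz₀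
    refine (hM z₀ h1).trans (Real.exp_le_exp.2 ?_)
    exact Real.rpow_le_rpow (norm_nonneg _) (by linarith) hβ.le
  have h1 := two_pow_card_mul_norm_sub_le hf (r := 2 * s) (by linarith)
    (M := Real.exp ((6 * s) ^ β)) (fun z hz => by
      have h3 : ‖z‖ = 6 * s := by linarith
      rw [← h3]
      exact hM z (by linarith)) S (fun z hz => ⟨(hS z hz).2.1.le, (hS z hz).2.2⟩)
  have h2 : 1 ≤ ‖f 0 - w‖ := by
    have := norm_sub_norm_le w (f 0)
    rw [norm_sub_rev]; linarith
  have h3 : (2 : ℝ) ^ S.card ≤ 2 * Real.exp ((6 * s) ^ β) := by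
    have : (2 : ℝ) ^ S.card * 1 ≤ 2 ^ S.card * ‖f 0 - w‖ := by gcongr
    linarith
  have h4 := Real.log_le_log (by positivity) h3
  rw [Real.log_pow, Real.log_mul two_ne_zero (Real.exp_ne_zero _), Real.log_exp] at h4
  have h5 := Real.log_two_gt_d9
  have h7 := Real.log_two_lt_d9
  have h8 : (S.card : ℝ) * 0.69 ≤ S.card * Real.log 2 := by gcongr; linarith
  linarith

lemma logArea_annulus_inter_preimage_le {f : ℂ → ℂ} (hf : Differentiable ℂ f) {R₀ : ℝ}
    (hR : IsExpansionRadius f R₀) {α β r₁ : ℝ} (hα : 0 < α) (hβ : 0 < β)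
    (hM : ∀ z, r₁ ≤ ‖z‖ → ‖f z‖ ≤ Real.exp (‖z‖ ^ β)) :
    ∃ C, 0 < C ∧ ∀ᶠ s : ℝ in atTop, ∀ E : Set ℂ, MeasurableSet E →
      logArea ({z | s ≤ ‖z‖ ∧ ‖z‖ < 2 * s ∧ Real.exp (‖z‖ ^ α) ≤ ‖f z‖} ∩ f ⁻¹' E) ≤
        ENNReal.ofReal (C * s ^ (β - 2 * α)) * logArea E := by
  refine ⟨3 * 6 ^ β * 768 ^ 2, by positivity, ?_⟩
  have hpow : Tendsto (fun s : ℝ => s ^ α) atTop atTop := tendsto_rpow_atTop hα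
  have hexp : Tendsto (fun s : ℝ => Real.exp (s ^ α)) atTop atTop :=
    Real.tendsto_exp_atTop.comp hpow
  filter_upwards [eventually_ge_atTop 1, eventually_ge_atTop r₁,
    hpow.eventually_ge_atTop (2 * Real.log R₀), hexp.eventually_gt_atTop R₀,
    hexp.eventually_ge_atTop (‖f 0‖ + 1)] with s hs1 hsr hsl hsR hs0 E hE
  have hs0' : 0 < s := by linarith
  have hR0 : 0 < R₀ := one_pos.trans_le hR.one_le
  set A : Set ℂ := {z | s ≤ ‖z‖ ∧ ‖z‖ < 2 * s ∧ Real.exp (‖z‖ ^ α) ≤ ‖f z‖} with hA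
  have hAm : MeasurableSet A := by
    have hfm : Measurable f := hf.continuous.measurable
    refine (measurableSet_le measurable_const measurable_norm).inter
      ((measurableSet_lt measurable_norm measurable_const).inter
        (measurableSet_le ?_ hfm.norm))
    exact Real.measurable_exp.comp (measurable_norm.pow_const α)
  have hApow : ∀ z ∈ A, s ^ α ≤ ‖z‖ ^ α := fun z hz =>
    Real.rpow_le_rpow hs0'.le hz.1 hα.le
  have hAexp : ∀ z ∈ A, Real.exp (s ^ α) ≤ ‖f z‖ := fun z hz =>
    (Real.exp_le_exp.2 (hApow z hz)).trans hz.2.2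
  have key := logArea_inter_preimage_le hf hAm hE (N := 3 * (6 * s) ^ β) (c := s ^ α / 768)
    (by positivity) (fun z hz => ?_) (fun z hz => ?_) (fun w S hS => ?_)
  · refine key.trans (le_of_eq ?_)
    congr 2
    rw [Real.mul_rpow (by norm_num) hs0'.le, Real.rpow_sub hs0', two_mul, Real.rpow_add hs0']
    field_simp
  · have h1 := hR.expansion z (hsR.trans_le (hAexp z hz))
    have h2 : s ^ α ≤ Real.log ‖f z‖ := by
      rw [Real.le_log_iff_exp_le ((Real.exp_pos _).trans_le (hAexp z hz))]
      exact hAexp z hz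
    have h3 : s ^ α / 2 * ‖f z‖ ≤ (Real.log ‖f z‖ - Real.log R₀) * ‖f z‖ := by
      gcongr; linarith
    linarith
  · exact norm_pos_iff.1 ((Real.exp_pos _).trans_le (hAexp z hz))
  · rcases S.eq_empty_or_nonempty with rfl | ⟨z₀, hz₀⟩
    · simp only [Finset.card_empty, Nat.cast_zero]; positivity
    refine card_le_of_norm_le_exp_rpow hf hs1 hβ (fun z hz => hM z (hsr.trans hz)) (w := w) ?_ S
      fun z hz => ⟨(hS z hz).1.1, (hS z hz).1.2.1, (hS z hz).2⟩
    rw [← (hS z₀ hz₀).2]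
    exact hs0.trans (hAexp z₀ (hS z₀ hz₀).1)

lemma exists_two_pow_mul_le_lt {R x : ℝ} (hR : 0 < R) (hx : R ≤ x) :
    ∃ k : ℕ, 2 ^ k * R ≤ x ∧ x < 2 * (2 ^ k * R) := by
  obtain ⟨k, hk1, hk2⟩ := exists_nat_pow_near (x := x / R) (y := 2)
    (by rw [le_div_iff₀ hR]; linarith) one_lt_two
  refine ⟨k, (le_div_iff₀ hR).1 hk1, ?_⟩
  rw [div_lt_iff₀ hR, pow_succ] at hk2
  linarith

lemma logArea_outside_inter_preimage_le {f : ℂ → ℂ} (hf : Differentiable ℂ f) {R₀ : ℝ}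
    (hR : IsExpansionRadius f R₀) {α β r₁ : ℝ} (hα : 0 < α) (hβ : 0 < β) (hαβ : β < 2 * α)
    (hM : ∀ z, r₁ ≤ ‖z‖ → ‖f z‖ ≤ Real.exp (‖z‖ ^ β)) :
    ∀ᶠ R : ℝ in atTop, ∀ E : Set ℂ, MeasurableSet E →
      logArea ({z | R ≤ ‖z‖ ∧ Real.exp (‖z‖ ^ α) ≤ ‖f z‖} ∩ f ⁻¹' E) ≤
        ENNReal.ofReal (1 / 2) * logArea E := by
  obtain ⟨C, hC, hev⟩ := logArea_annulus_inter_preimage_le hf hR hα hβ hM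
  set η := 2 * α - β with hη
  have hη0 : 0 < η := by linarith
  set q : ℝ := 2 ^ (-η) with hq
  have hq0 : 0 < q := by positivity
  have hq1 : q < 1 := Real.rpow_lt_one_of_one_lt_of_neg one_lt_two (by linarith)
  obtain ⟨s₀, hs₀⟩ := eventually_atTop.1 hev
  have hsmall : Tendsto (fun R : ℝ => C * R ^ (-η) * (1 - q)⁻¹) atTop (𝓝 0) := by
    have := ((tendsto_rpow_neg_atTop hη0).const_mul C).mul_const (1 - q)⁻¹
    simpa using this
  filter_upwards [eventually_ge_atTop s₀, eventually_ge_atTop 1,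
    hsmall.eventually (gt_mem_nhds (by norm_num : (0 : ℝ) < 1 / 2))] with R hRs hR1 hRq E hE
  have hR0 : 0 < R := by linarith
  have hsub : {z | R ≤ ‖z‖ ∧ Real.exp (‖z‖ ^ α) ≤ ‖f z‖} ∩ f ⁻¹' E ⊆
      ⋃ k : ℕ, ({z | 2 ^ k * R ≤ ‖z‖ ∧ ‖z‖ < 2 * (2 ^ k * R) ∧
        Real.exp (‖z‖ ^ α) ≤ ‖f z‖} ∩ f ⁻¹' E) := by
    rintro z ⟨⟨hz1, hz2⟩, hz3⟩
    obtain ⟨k, hk1, hk2⟩ := exists_two_pow_mul_le_lt hR0 hz1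
    exact mem_iUnion.2 ⟨k, ⟨hk1, hk2, hz2⟩, hz3⟩
  have hterm : ∀ k : ℕ, C * (2 ^ k * R) ^ (β - 2 * α) = C * R ^ (-η) * q ^ k := by
    intro k
    have h1 : β - 2 * α = -η := by rw [hη]; ring
    rw [h1, Real.mul_rpow (by positivity) hR0.le, hq, ← Real.rpow_natCast (2 ^ (-η)) k,
      ← Real.rpow_mul (by norm_num), ← Real.rpow_natCast 2 k, ← Real.rpow_mul (by norm_num)]
    ring_nf
  calc logArea ({z | R ≤ ‖z‖ ∧ Real.exp (‖z‖ ^ α) ≤ ‖f z‖} ∩ f ⁻¹' E)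
      ≤ ∑' k : ℕ, logArea ({z | 2 ^ k * R ≤ ‖z‖ ∧ ‖z‖ < 2 * (2 ^ k * R) ∧
        Real.exp (‖z‖ ^ α) ≤ ‖f z‖} ∩ f ⁻¹' E) := (logArea_mono hsub).trans (logArea_iUnion_le _)
    _ ≤ ∑' k : ℕ, ENNReal.ofReal (C * R ^ (-η) * q ^ k) * logArea E := by
        refine ENNReal.tsum_le_tsum fun k => ?_
        rw [← hterm]
        refine hs₀ _ (hRs.trans ?_) E hE
        exact le_mul_of_one_le_left hR0.le (one_le_pow₀ one_le_two)
    _ = ENNReal.ofReal (C * R ^ (-η) * (1 - q)⁻¹) * logArea E := by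
        rw [ENNReal.tsum_mul_right, ← ENNReal.ofReal_tsum_of_nonneg (fun k => by positivity)
          ((summable_geometric_of_lt_one hq0.le hq1).mul_left _), tsum_mul_left,
          tsum_geometric_of_lt_one hq0.le hq1]
    _ ≤ ENNReal.ofReal (1 / 2) * logArea E := by gcongr

/-- The points whose orbits eventually leave the region of fast growth have finite logarithmic
area near infinity. -/
theorem logArea_exists_iterate_lt {f : ℂ → ℂ} (hf : Differentiable ℂ f) {R₀ : ℝ}
    (hR : IsExpansionRadius f R₀) {α β r₁ : ℝ} (hα : 0 < α) (hβ : 0 < β) (hαβ : β < 2 * α)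
    (hM : ∀ z, r₁ ≤ ‖z‖ → ‖f z‖ ≤ Real.exp (‖z‖ ^ β))
    (hyp : logArea {z : ℂ | z ∈ Delta ∧ ‖f z‖ < Real.exp (‖z‖ ^ α)} < ⊤) :
    ∀ᶠ R : ℝ in atTop, logArea {z | R ≤ ‖z‖ ∧
      ∃ n, ‖f^[n + 1] z‖ < Real.exp (‖f^[n] z‖ ^ α)} < ⊤ := by
  have hpow : Tendsto (fun s : ℝ => Real.exp (s ^ α) * s ^ (-1 : ℝ)) atTop atTop := by
    have h1 := (tendsto_exp_div_rpow_atTop (1 / α)).comp (tendsto_rpow_atTop hα)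
    refine h1.congr' ?_
    filter_upwards [eventually_gt_atTop 0] with s hs
    simp only [Function.comp]
    rw [← Real.rpow_mul hs.le, mul_one_div_cancel hα.ne', Real.rpow_one, Real.rpow_neg_one,
      div_eq_mul_inv]
  obtain ⟨s₀, hs₀⟩ := eventually_atTop.1 (hpow.eventually_ge_atTop 1)
  filter_upwards [logArea_outside_inter_preimage_le hf hR hα hβ hαβ hM,
    eventually_ge_atTop 1, eventually_ge_atTop s₀] with R hcontr hR1 hRs
  have hfm : Measurable f := hf.continuous.measurable
  have hexpm : Measurable fun z : ℂ => Real.exp (‖z‖ ^ α) :=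
    Real.measurable_exp.comp (measurable_norm.pow_const α)
  set B : Set ℂ := {z | R ≤ ‖z‖ ∧ ‖f z‖ < Real.exp (‖z‖ ^ α)} with hB
  set T : Set ℂ := {z | R ≤ ‖z‖ ∧ Real.exp (‖z‖ ^ α) ≤ ‖f z‖} with hT
  have hBm : MeasurableSet B := (measurableSet_le measurable_const measurable_norm).inter
    (measurableSet_lt hfm.norm hexpm)
  have hTm : MeasurableSet T := (measurableSet_le measurable_const measurable_norm).inter
    (measurableSet_le hexpm hfm.norm)
  set Φ : Set ℂ → Set ℂ := fun E => T ∩ f ⁻¹' E with hΦ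
  have hEm : ∀ n, MeasurableSet (Φ^[n] B) := by
    intro n
    induction n with
    | zero => exact hBm
    | succ n ih =>
      rw [Function.iterate_succ_apply']
      exact hTm.inter (hfm ih)
  have hbound : ∀ n, logArea (Φ^[n] B) ≤ ENNReal.ofReal (1 / 2) ^ n * logArea B := by
    intro n
    induction n with
    | zero => simp
    | succ n ih =>
      rw [Function.iterate_succ_apply', pow_succ', mul_assoc]
      exact (hcontr _ (hEm n)).trans (by gcongr)
  have hBfin : logArea B < ⊤ := by
    refine (logArea_mono ?_).trans_lt hyp
    exact fun z hz => ⟨hR1.trans hz.1, hz.2⟩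
  have hgrow : ∀ z ∈ T, R ≤ ‖f z‖ := by
    intro z hz
    have hz0 : 0 < ‖z‖ := by linarith [hz.1]
    have h1 := hs₀ ‖z‖ (hRs.trans hz.1)
    rw [Real.rpow_neg_one, ← div_eq_mul_inv, le_div_iff₀ hz0, one_mul] at h1
    exact hz.1.trans (h1.trans hz.2)
  have hmem : ∀ n, ∀ z, R ≤ ‖z‖ → ‖f^[n + 1] z‖ < Real.exp (‖f^[n] z‖ ^ α) →
      ∃ m, z ∈ Φ^[m] B := by
    intro n
    induction n with
    | zero => exact fun z hz h => ⟨0, hz, h⟩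
    | succ n ih =>
      intro z hz h
      by_cases hzB : ‖f z‖ < Real.exp (‖z‖ ^ α)
      · exact ⟨0, hz, hzB⟩
      have hzT : z ∈ T := ⟨hz, not_lt.1 hzB⟩
      obtain ⟨m, hm⟩ := ih (f z) (hgrow z hzT) h
      exact ⟨m + 1, by rw [Function.iterate_succ_apply']; exact ⟨hzT, hm⟩⟩
  calc logArea {z | R ≤ ‖z‖ ∧ ∃ n, ‖f^[n + 1] z‖ < Real.exp (‖f^[n] z‖ ^ α)}
      ≤ ∑' n, logArea (Φ^[n] B) := by
        refine (logArea_mono ?_).trans (logArea_iUnion_le _)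
        rintro z ⟨hz, n, hn⟩
        exact mem_iUnion.2 (hmem n z hz hn)
    _ ≤ ∑' n, ENNReal.ofReal (1 / 2) ^ n * logArea B := ENNReal.tsum_le_tsum hbound
    _ < ⊤ := by
        rw [ENNReal.tsum_mul_right, ENNReal.tsum_geometric]
        refine ENNReal.mul_lt_top ?_ hBfin
        rw [ENNReal.inv_lt_top, tsub_pos_iff_lt]
        exact ENNReal.ofReal_lt_one.2 (by norm_num)

end ContractionOfPreimages

section MaximumModulus

variable {f : ℂ → ℂ}

lemma norm_le_maxMod (hf : Continuous f) (z : ℂ) : ‖f z‖ ≤ maxMod f ‖z‖ := by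
  have h : {w : ℂ | ‖w‖ = ‖z‖} = sphere 0 ‖z‖ := by ext; simp
  refine le_csSup ?_ ⟨z, rfl, rfl⟩
  rw [h]
  exact ((isCompact_sphere 0 ‖z‖).image hf.norm).bddAbove

lemma TranscendentalEntire.eventually_lt_maxMod (hf : TranscendentalEntire f) :
    ∀ᶠ r in atTop, r < maxMod f r := by
  by_contra hcon
  refine hf.2 (exists_polynomial_of_frequently_norm_le_pow hf.1 (C := 1) (n := 1)
    ((not_eventually.1 hcon).mono fun r hr z hz => ?_))
  have := norm_le_maxMod hf.1.continuous z
  rw [hz] at this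
  linarith [not_lt.1 hr]

lemma eventually_maxMod_le_exp_rpow (hf : TranscendentalEntire f) {ρ β : ℝ}
    (hord : entireOrder f = (ρ : EReal)) (hβ : ρ < β) :
    ∀ᶠ r in atTop, maxMod f r ≤ Real.exp (r ^ β) := by
  have h1 : limsup (fun r : ℝ => ((Real.log (Real.log (maxMod f r)) / Real.log r : ℝ) : EReal))
      atTop < (β : EReal) := by
    have : entireOrder f < (β : EReal) := by rw [hord]; exact_mod_cast hβ
    exact this
  filter_upwards [eventually_lt_of_limsup_lt h1, hf.eventually_lt_maxMod,
    eventually_ge_atTop (Real.exp 1)] with r hr hM hre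
  have hr0 : 0 < r := (Real.exp_pos 1).trans_le hre
  have hM0 : 0 < maxMod f r := hr0.trans hM
  have hlogr : 1 ≤ Real.log r := by rwa [Real.le_log_iff_exp_le hr0]
  have hlogM : 0 < Real.log (maxMod f r) := by
    have := Real.log_lt_log hr0 hM
    linarith
  have h2 : Real.log (Real.log (maxMod f r)) / Real.log r < β := by exact_mod_cast hr
  rw [div_lt_iff₀ (by linarith)] at h2
  rw [← Real.log_le_iff_le_exp hM0, Real.rpow_def_of_pos hr0,
    ← Real.log_le_iff_le_exp hlogM]
  linarith

lemma order_nonneg (hf : TranscendentalEntire f) {ρ : ℝ} (hord : entireOrder f = (ρ : EReal)) :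
    0 ≤ ρ := by
  have h : (0 : EReal) ≤ entireOrder f := by
    refine le_limsup_of_frequently_le (Eventually.frequently ?_)
    filter_upwards [hf.eventually_lt_maxMod, eventually_ge_atTop (Real.exp 1)] with r hM hre
    have hr0 : 0 < r := (Real.exp_pos 1).trans_le hre
    have hlogr : 1 ≤ Real.log r := by rwa [Real.le_log_iff_exp_le hr0]
    have hlogM := Real.log_lt_log hr0 hM
    have : 0 ≤ Real.log (Real.log (maxMod f r)) / Real.log r :=
      div_nonneg (Real.log_nonneg (by linarith)) (by linarith)
    exact_mod_cast this
  rw [hord] at h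
  exact_mod_cast h

end MaximumModulus

section FastEscaping

variable {f : ℂ → ℂ}

lemma exists_add_le_mul_exp {α β : ℝ} (hα : 0 < α) (hβ : 0 < β) :
    ∃ K, 0 ≤ K ∧ β + K ≤ α * Real.exp K := by
  set K := 2 * (1 + β) / α with hK
  have hK0 : 0 ≤ K := by positivity
  refine ⟨K, hK0, ?_⟩
  have h1 := Real.quadratic_le_exp_of_nonneg hK0
  have h2 : α * K = 2 * (1 + β) := by rw [hK]; field_simp
  have h3 := mul_le_mul_of_nonneg_left h1 hα.le
  have h4 : α * K ^ 2 = 2 * (1 + β) * K := by rw [← h2]; ring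
  nlinarith [mul_nonneg hβ.le hK0]

/-- Comparison of an orbit growing like `exp (x ^ α)` with iterates of the maximum modulus. -/
lemma mem_fastEscapingSet_of_exp_rpow_le {α β R : ℝ} (hα : 0 < α) (hαβ : α ≤ β)
    (hR1 : 1 ≤ R) (hR : ∀ r, R ≤ r → r < maxMod f r)
    (hM : ∀ r, R ≤ r → maxMod f r ≤ Real.exp (r ^ β)) {z : ℂ}
    (hz : ∀ n, Real.exp (‖f^[n] z‖ ^ α) ≤ ‖f^[n + 1] z‖)
    (hesc : Tendsto (fun n => ‖f^[n] z‖) atTop atTop) : z ∈ fastEscapingSet f := by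
  obtain ⟨K, hK0, hK⟩ := exists_add_le_mul_exp hα (hα.trans_le hαβ)
  have hm : ∀ k, R ≤ (maxMod f)^[k] R := by
    intro k
    induction k with
    | zero => exact le_rfl
    | succ k ih =>
      rw [Function.iterate_succ_apply']
      exact ih.trans (hR _ ih).le
  have hlog : Tendsto (fun n => α * Real.log ‖f^[n] z‖) atTop atTop :=
    (Real.tendsto_log_atTop.comp hesc).const_mul_atTop hα
  obtain ⟨L, hL1, hL2⟩ := ((hlog.eventually_ge_atTop (β * Real.log R + K)).and
    (hesc.eventually_gt_atTop 0)).exists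
  have key : ∀ k, 0 < ‖f^[L + k] z‖ ∧
      β * Real.log ((maxMod f)^[k] R) + K ≤ α * Real.log ‖f^[L + k] z‖ := by
    intro k
    induction k with
    | zero => exact ⟨hL2, hL1⟩
    | succ k ih =>
      obtain ⟨ih1, ih2⟩ := ih
      set x := ‖f^[L + k] z‖
      set m := (maxMod f)^[k] R
      have hm0 : 0 < m := by linarith [hm k]
      have hx' := hz (L + k)
      have hx'0 : 0 < ‖f^[L + k + 1] z‖ := (Real.exp_pos _).trans_le hx'
      refine ⟨hx'0, ?_⟩
      rw [Function.iterate_succ_apply', ← add_assoc]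
      have h1 : x ^ α ≤ Real.log ‖f^[L + k + 1] z‖ := (Real.le_log_iff_exp_le hx'0).2 hx'
      have hM0 : 0 < maxMod f m := hm0.trans (hR m (hm k))
      have h2 : Real.log (maxMod f m) ≤ m ^ β := (Real.log_le_iff_le_exp hM0).2 (hM m (hm k))
      have h3 : Real.exp K * m ^ β ≤ x ^ α := by
        rw [Real.rpow_def_of_pos hm0, Real.rpow_def_of_pos ih1, ← Real.exp_add]
        exact Real.exp_le_exp.2 (by linarith)
      have h4 : 1 ≤ m ^ β := Real.one_le_rpow (by linarith [hm k]) (hα.le.trans hαβ)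
      have h5 : (β + K) * m ^ β ≤ α * x ^ α := by
        calc (β + K) * m ^ β ≤ α * Real.exp K * m ^ β := by gcongr
          _ = α * (Real.exp K * m ^ β) := by ring
          _ ≤ _ := by gcongr
      have h6 : β * Real.log (maxMod f m) ≤ β * m ^ β := by gcongr; linarith
      have h7 : α * x ^ α ≤ α * Real.log ‖f^[L + k + 1] z‖ := by gcongr
      nlinarith
  refine ⟨R, by linarith, hR, L, fun n hn => ?_⟩
  obtain ⟨k, rfl⟩ := Nat.exists_eq_add_of_le hn.le
  rw [Nat.add_sub_cancel_left]
  obtain ⟨h1, h2⟩ := key k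
  have hm0 : 0 < (maxMod f)^[k] R := by linarith [hm k]
  rw [← Real.log_le_log_iff hm0 h1]
  have h3 : 0 ≤ Real.log ((maxMod f)^[k] R) := Real.log_nonneg (hR1.trans (hm k))
  refine le_of_mul_le_mul_left ?_ hα
  have := mul_le_mul_of_nonneg_right hαβ h3
  linarith

lemma exists_forall_mul_le_exp_rpow {α : ℝ} (hα : 0 < α) :
    ∀ᶠ s : ℝ in atTop, 2 * s ≤ Real.exp (s ^ α) := by
  have h1 := (tendsto_exp_div_rpow_atTop (1 / α)).comp (tendsto_rpow_atTop hα)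
  filter_upwards [h1.eventually_ge_atTop 2, eventually_gt_atTop 0] with s hs hs0
  simp only [Function.comp] at hs
  rwa [← Real.rpow_mul hs0.le, mul_one_div_cancel hα.ne', Real.rpow_one, le_div_iff₀ hs0] at hs

end FastEscaping

section LogAreaDelta

lemma logArea_annulus_lt_top (R : ℝ) : logArea {z : ℂ | 1 ≤ ‖z‖ ∧ ‖z‖ < R} < ⊤ := by
  have hm : MeasurableSet {z : ℂ | 1 ≤ ‖z‖ ∧ ‖z‖ < R} :=
    (measurableSet_le measurable_const measurable_norm).inter
      (measurableSet_lt measurable_norm measurable_const)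
  calc logArea {z : ℂ | 1 ≤ ‖z‖ ∧ ‖z‖ < R}
      ≤ ∫⁻ _ in {z : ℂ | 1 ≤ ‖z‖ ∧ ‖z‖ < R}, 1 := by
        refine setLIntegral_mono' hm fun z hz => ENNReal.ofReal_le_one.2 ?_
        exact inv_le_one_of_one_le₀ (one_le_pow₀ hz.1)
    _ = volume {z : ℂ | 1 ≤ ‖z‖ ∧ ‖z‖ < R} := by simp
    _ ≤ volume (ball (0 : ℂ) R) := measure_mono fun z hz => by simpa using hz.2
    _ < ⊤ := measure_ball_lt_top

lemma logArea_eq_zero_of_volume {A : Set ℂ} (hA : volume A = 0) : logArea A = 0 :=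
  setLIntegral_measure_zero _ _ hA

lemma logArea_Delta : logArea Delta = ⊤ := by
  by_contra hfin
  set A₁ : Set ℂ := {z | 1 ≤ ‖z‖ ∧ ‖z‖ < 2} with hA₁
  set A₂ : Set ℂ := {z | 2 ≤ ‖z‖} with hA₂
  have hA₁m : MeasurableSet A₁ := (measurableSet_le measurable_const measurable_norm).inter
      (measurableSet_lt measurable_norm measurable_const)
  have hA₂m : MeasurableSet A₂ := measurableSet_le measurable_const measurable_norm
  have hΔm : MeasurableSet Delta := measurableSet_le measurable_const measurable_norm
  have hunion : Delta = A₂ ∪ A₁ := by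
    ext z
    simp only [Delta, hA₁, hA₂, mem_ofPred_eq, mem_union]
    constructor
    · intro h
      rcases le_or_gt 2 ‖z‖ with h2 | h2
      · exact Or.inl h2
      · exact Or.inr ⟨h, h2⟩
    · rintro (h | h)
      · linarith
      · exact h.1
  have hdisj : Disjoint A₂ A₁ := disjoint_left.2 fun z h1 h2 => absurd h2.2 (not_lt.2 h1)
  have hsum : logArea Delta = logArea A₂ + logArea A₁ := by
    rw [hunion]; exact lintegral_union hA₁m hdisj
  have hscale : logArea Delta ≤ logArea A₂ := by
    have h1 := logArea_inter_preimage_le (f := fun z => 2 * z) (by fun_prop) hΔm hA₂m (N := 1)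
      (c := 1) one_pos (fun z _ => ?_) (fun z hz => ?_) (fun w S hS => ?_)
    · have h2 : Delta ∩ (fun z : ℂ => 2 * z) ⁻¹' A₂ = Delta := by
        refine inter_eq_left.2 fun z hz => ?_
        have : 1 ≤ ‖z‖ := hz
        simp only [hA₂, mem_preimage, mem_ofPred_eq, norm_mul, Complex.norm_ofNat]
        linarith
      rw [h2] at h1
      simpa using h1
    · have : deriv (fun z : ℂ => 2 * z) z = 2 := by
        simp
      rw [this]; simp [mul_comm]
    · have : 1 ≤ ‖z‖ := hz
      refine mul_ne_zero two_ne_zero (norm_pos_iff.1 (by linarith))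
    · have : S.card ≤ 1 := Finset.card_le_one.2 fun a ha b hb => by
        have h3 := (hS a ha).2.trans (hS b hb).2.symm
        exact mul_left_cancel₀ two_ne_zero h3
      exact_mod_cast this
  have hA₂fin : logArea A₂ ≠ ⊤ := by
    intro h; rw [hsum, h] at hfin; simp at hfin
  have hzero : logArea A₁ = 0 := by
    rw [hsum] at hscale
    have : logArea A₂ + logArea A₁ ≤ logArea A₂ + 0 := by simpa using hscale
    simpa using (ENNReal.add_le_add_iff_left hA₂fin).1 this
  have hball : ball (3 / 2 : ℂ) (1 / 2) ⊆ A₁ := by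
    intro z hz
    rw [mem_ball_iff_norm] at hz
    have h32 : ‖(3 / 2 : ℂ)‖ = 3 / 2 := by simp
    have h1 := norm_sub_norm_le (3 / 2 : ℂ) z
    have h2 := norm_sub_norm_le z (3 / 2 : ℂ)
    rw [norm_sub_rev] at h1
    exact ⟨by linarith, by linarith⟩
  have hlow : ENNReal.ofReal (1 / 4) * volume A₁ ≤ logArea A₁ := by
    rw [← setLIntegral_const]
    refine setLIntegral_mono' hA₁m fun z hz => ENNReal.ofReal_le_ofReal ?_
    rw [one_div]
    have : 0 < ‖z‖ := one_pos.trans_le hz.1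
    refine inv_anti₀ (by positivity) ?_
    nlinarith [hz.2]
  have hpos : 0 < volume A₁ :=
    (measure_ball_pos volume (3 / 2 : ℂ) (by norm_num : (0 : ℝ) < 1 / 2)).trans_le
      (measure_mono hball)
  rw [hzero] at hlow
  have h4 : (0 : ℝ≥0∞) < ENNReal.ofReal (1 / 4) := ENNReal.ofReal_pos.2 (by norm_num)
  exact absurd hlow (not_le.2 (ENNReal.mul_pos h4.ne' hpos.ne'))

end LogAreaDelta

theorem fast_escaping_positive_measure_ELclass
    (f : ℂ → ℂ) (hf : ELClass f) (ρ : ℝ) (hord : entireOrder f = (ρ : EReal))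
    (ε : ℝ) (hε : 0 < ε)
    (hyp : logArea {z : ℂ | z ∈ Delta ∧ ‖f z‖ < Real.exp (‖z‖ ^ (ρ / 2 + ε))} < ⊤) :
    logArea (Delta \ fastEscapingSet f) < ⊤ ∧
      logArea (Delta \ juliaSet f) < ⊤ ∧ 0 < volume (juliaSet f) := by
  obtain ⟨R₀, hR₀⟩ := hf.exists_isExpansionRadius
  have hρ := order_nonneg hf.1 hord
  have hα : 0 < ρ / 2 + ε := by linarith
  obtain ⟨R₁, hR₁⟩ := eventually_atTop.1 (((eventually_maxMod_le_exp_rpow hf.1 hord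
    (lt_add_of_pos_right ρ hε)).and hf.1.eventually_lt_maxMod).and (eventually_ge_atTop 1))
  obtain ⟨s₀, hs₀⟩ := eventually_atTop.1 (exists_forall_mul_le_exp_rpow hα)
  obtain ⟨R, hX, hRs, hRR⟩ := ((logArea_exists_iterate_lt hf.1.1 hR₀ hα
    (by linarith : 0 < ρ + ε) (by linarith) (fun z hz => (norm_le_maxMod hf.1.1.continuous z).trans
      (hR₁ _ hz).1.1) hyp).and ((eventually_ge_atTop s₀).and (eventually_ge_atTop R₀))).exists
  set X : Set ℂ := {z | R ≤ ‖z‖ ∧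
    ∃ n, ‖f^[n + 1] z‖ < Real.exp (‖f^[n] z‖ ^ (ρ / 2 + ε))} with hXdef
  have hR0 : 0 < R := one_pos.trans_le (hR₀.one_le.trans hRR)
  have hgood : ∀ z, R ≤ ‖z‖ → z ∉ X → z ∈ fastEscapingSet f ∧ z ∈ juliaSet f := by
    intro z hz hzX
    have hgrow : ∀ n, Real.exp (‖f^[n] z‖ ^ (ρ / 2 + ε)) ≤ ‖f^[n + 1] z‖ := fun n =>
      not_lt.1 fun h => hzX ⟨hz, n, h⟩
    have hpow : ∀ n, 2 ^ n * R ≤ ‖f^[n] z‖ := by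
      intro n
      induction n with
      | zero => simpa using hz
      | succ n ih =>
        have h1 : R ≤ ‖f^[n] z‖ := le_trans (le_mul_of_one_le_left hR0.le
          (one_le_pow₀ one_le_two)) ih
        have h2 := (hs₀ _ (hRs.trans h1)).trans (hgrow n)
        rw [pow_succ]
        linarith
    have hesc : Tendsto (fun n => ‖f^[n] z‖) atTop atTop :=
      tendsto_atTop_mono hpow (Filter.Tendsto.atTop_mul_const hR0
        (_root_.tendsto_pow_atTop_atTop_of_one_lt (r := (2 : ℝ)) one_lt_two))
    refine ⟨mem_fastEscapingSet_of_exp_rpow_le hα (by linarith : ρ / 2 + ε ≤ ρ + ε)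
      (hR₁ R₁ le_rfl).2 (fun r hr => (hR₁ r hr).1.2) (fun r hr => (hR₁ r hr).1.1) hgrow hesc,
      hR₀.mem_juliaSet hf.1.1 (norm_pos_iff.1 (hR0.trans_le hz)) (fun n => ?_) hesc⟩
    have h1 : (1 : ℝ) < 2 ^ (n + 1) := one_lt_pow₀ _root_.one_lt_two (Nat.succ_ne_zero n)
    refine lt_of_lt_of_le ?_ (hpow (n + 1))
    nlinarith
  have hfin : ∀ J : Set ℂ, (∀ z, R ≤ ‖z‖ → z ∉ X → z ∈ J) → logArea (Delta \ J) < ⊤ := by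
    intro J hJ
    have hsub : Delta \ J ⊆ {z : ℂ | 1 ≤ ‖z‖ ∧ ‖z‖ < R} ∪ X := by
      rintro z ⟨hz1, hz2⟩
      rcases lt_or_ge ‖z‖ R with h | h
      · exact Or.inl ⟨hz1, h⟩
      · exact Or.inr (by_contra fun hX' => hz2 (hJ z h hX'))
    exact ((logArea_mono hsub).trans (logArea_union_le _ _)).trans_lt
      (ENNReal.add_lt_top.2 ⟨logArea_annulus_lt_top R, hX⟩)
  have hJfin := hfin (juliaSet f) fun z h1 h2 => (hgood z h1 h2).2
  refine ⟨hfin _ fun z h1 h2 => (hgood z h1 h2).1, hJfin, pos_iff_ne_zero.2 fun h0 => ?_⟩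
  have h1 : logArea Delta ≤ logArea (Delta \ juliaSet f) + logArea (juliaSet f) := by
    refine (logArea_mono ?_).trans (logArea_union_le _ _)
    rw [sdiff_union_self]
    exact subset_union_left
  rw [logArea_eq_zero_of_volume h0, add_zero, logArea_Delta] at h1
  exact absurd hJfin (not_lt.2 h1)
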